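/- arXiv:2205.04704 — 2 statements merged into one kernel-verified Lean document; each statement's English description precedes it below -/
import Mathlib

section
/- If A is a separable, unital C*-algebra with real rank zero and nuclear dimension at most one, then A has weak complexity rank at most one: for every finite subset X of A and every ε > 0 there exist finite-dimensional C*-subalgebras C and D of A and a positive contraction h ∈ A such that ‖[h, x]‖ < ε, hx ∈_ε C, and (1 − h)x ∈_ε D for all x ∈ X. -/
universe u v

/-- A square matrix over a C*-algebra (or star ring) is positive iff it has the form
`star y * y`. -/
def MatIsPos {R : Type*} [NonUnitalSemiring R] [StarRing R] {k : ℕ}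
    (x : Matrix (Fin k) (Fin k) R) : Prop :=
  ∃ y : Matrix (Fin k) (Fin k) R, x = star y * y

/-- A ℂ-linear map between C*-algebras is completely positive if, for every `k`, the induced
map on `k × k` matrices maps positive matrices to positive matrices. -/
def IsCP {A : Type u} {B : Type v} [NonUnitalCStarAlgebra A] [NonUnitalCStarAlgebra B]
    (φ : A →ₗ[ℂ] B) : Prop :=
  ∀ (k : ℕ) (x : Matrix (Fin k) (Fin k) A), MatIsPos x → MatIsPos (x.map φ)

/-- The data witnessing one instance of the nuclear dimension condition: a finite-dimensional
C*-algebra `F = F₀ ⊕ ⋯ ⊕ F_n` (modeled as a finite product), a contractive completely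
positive map `ψ : A → F`, and a completely positive map `φ : F → A` whose restriction to each
summand is contractive and order zero, with `φ ∘ ψ` `ε`-approximating the identity on `X`. -/
def NucDimWitness (A : Type u) [NonUnitalCStarAlgebra A] (n : ℕ) (X : Finset A) (ε : ℝ)
    (F : Fin (n + 1) → Type v) [∀ i, NonUnitalCStarAlgebra (F i)] : Prop :=
  (∀ i, FiniteDimensional ℂ (F i)) ∧
  ∃ (ψ : A →ₗ[ℂ] (∀ i, F i)) (φ : (∀ i, F i) →ₗ[ℂ] A),
    IsCP ψ ∧ (∀ a : A, ‖ψ a‖ ≤ ‖a‖) ∧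
    IsCP φ ∧
    (∀ i : Fin (n + 1),
      (∀ x : F i, ‖φ (Pi.single i x)‖ ≤ ‖x‖) ∧
      (∀ x y : F i, (∃ u, x = star u * u) → (∃ v, y = star v * v) → x * y = 0 →
        φ (Pi.single i x) * φ (Pi.single i y) = 0)) ∧
    (∀ x ∈ X, ‖φ (ψ x) - x‖ < ε)

/-- A C*-algebra `A` has nuclear dimension at most `n`. -/
def NuclearDimLE (n : ℕ) (A : Type u) [NonUnitalCStarAlgebra A] : Prop :=
  ∀ (X : Finset A) (ε : ℝ), 0 < ε →
    ∃ (F : Fin (n + 1) → Type) (instF : ∀ i, NonUnitalCStarAlgebra (F i)),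
      @NucDimWitness A _ n X ε F instF
/-- A C*-algebra has real rank zero if every self-adjoint element can be approximated in norm
by self-adjoint elements with finite spectrum. -/
def RealRankZero (A : Type u) [CStarAlgebra A] : Prop :=
  ∀ a : A, IsSelfAdjoint a → ∀ ε : ℝ, 0 < ε →
    ∃ b : A, IsSelfAdjoint b ∧ (spectrum ℝ b).Finite ∧ ‖a - b‖ < ε
/-- `a ∈_ε S`: there is `s ∈ S` with `‖a - s‖ < ε`. -/
def MemEps {A : Type u} [CStarAlgebra A] (ε : ℝ) (S : Set A) (a : A) : Prop :=
  ∃ s ∈ S, ‖a - s‖ < ε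

/-- A unital C*-algebra `A` has weak complexity rank at most one: for every finite subset
`X` of `A` and every `ε > 0` there are finite-dimensional C*-subalgebras `C`, `D` of `A` and
a positive contraction `h ∈ A` with `‖[h,x]‖ < ε`, `h x ∈_ε C` and `(1-h) x ∈_ε D` for all
`x ∈ X`. -/
def WeakCRLeOne (A : Type u) [CStarAlgebra A] : Prop :=
  ∀ (X : Finset A) (ε : ℝ), 0 < ε →
    ∃ C D : NonUnitalStarSubalgebra ℂ A,
      FiniteDimensional ℂ C ∧ FiniteDimensional ℂ D ∧
      ∃ h : A, (∃ x : A, h = star x * x) ∧ ‖h‖ ≤ 1 ∧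
        (∀ x ∈ X, ‖h * x - x * h‖ < ε) ∧
        (∀ x ∈ X, MemEps ε (C : Set A) (h * x)) ∧
        (∀ x ∈ X, MemEps ε (D : Set A) ((1 - h) * x))

theorem aux_quasi_fin {F : Type v} [NonUnitalCStarAlgebra F] [FiniteDimensional ℂ F] (a : F) :
    (quasispectrum ℝ a).Finite := by
  have : FiniteDimensional ℝ F := FiniteDimensional.complexToReal F
  have : Module.Finite ℝ (Unitization ℝ F) := by
    refine Module.Finite.of_surjective
      ((LinearMap.toSpanSingleton ℝ (Unitization ℝ F) 1).coprod (Unitization.inrHom ℝ ℝ F)) ?_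
    intro z
    refine ⟨(z.fst, z.snd), ?_⟩
    ext <;> simp
  rw [Unitization.quasispectrum_eq_spectrum_inr ℝ a]
  obtain ⟨p, hp, hpa⟩ : IsIntegral ℝ (a : Unitization ℝ F) := Algebra.IsIntegral.isIntegral _
  refine (p.roots.toFinset.finite_toSet).subset ?_
  intro t ht
  have h := spectrum.subset_polynomial_aeval (a : Unitization ℝ F) p ⟨t, ht, rfl⟩
  rw [Polynomial.aeval_def, hpa, spectrum.zero_eq] at h
  simp only [Finset.mem_coe, Multiset.mem_toFinset]
  rw [Polynomial.mem_roots hp.ne_zero]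
  exact h

theorem aux_fin_cont {s : Set ℝ} (hs : s.Finite) (f : ℝ → ℝ) : ContinuousOn f s :=
  hs.continuousOn f

/-- spectral projection in a finite spectrum situation -/
theorem aux_proj {F : Type v} [NonUnitalCStarAlgebra F] {a : F} (ha : IsSelfAdjoint a)
    (hfin : (quasispectrum ℝ a).Finite) (h0 : a ≠ 0) :
    ∃ (p : F) (l : ℝ), l ≠ 0 ∧ p ≠ 0 ∧ star p = p ∧ p * p = p ∧ a * p = (l : ℂ) • p := by
  have hc : ∀ f : ℝ → ℝ, ContinuousOn f (quasispectrum ℝ a) := fun f => hfin.continuousOn f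
  obtain ⟨l, hl, hl0⟩ : ∃ l ∈ quasispectrum ℝ a, l ≠ 0 := by
    by_contra! hcon
    apply h0
    have : cfcₙ (fun x : ℝ => x) a = cfcₙ (fun _ : ℝ => (0 : ℝ)) a := cfcₙ_congr (fun x hx => hcon x hx)
    rwa [cfcₙ_id' ℝ a, cfcₙ_const_zero] at this
  set f : ℝ → ℝ := fun t => if t = l then 1 else 0 with hf
  have f0 : f 0 = 0 := by simp [hf, hl0.symm]
  refine ⟨cfcₙ f a, l, hl0, ?_, ?_, ?_, ?_⟩
  · intro hz
    rw [← cfcₙ_const_zero ℝ a] at hz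
    have := (cfcₙ_eq_cfcₙ_iff_eqOn ha (hc _) f0 (hc _) rfl).1 hz hl
    simp [hf] at this
  · exact cfcₙ_predicate f a
  · rw [← cfcₙ_mul f f a (hc _) f0 (hc _) f0]
    congr 1; ext t; simp [hf]
  · have h1 : a * cfcₙ f a = cfcₙ (fun x : ℝ => x) a * cfcₙ f a := by rw [cfcₙ_id' ℝ a]
    rw [h1, ← cfcₙ_mul (fun x : ℝ => x) f a (hc _) rfl (hc _) f0]
    have : ((l:ℂ) • cfcₙ f a) = l • cfcₙ f a := by simp
    rw [this, ← cfcₙ_smul l f a (hc _) f0]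
    apply cfcₙ_congr
    intro t ht
    simp only [hf]; split_ifs with h <;> simp [h]

theorem aux_span_proj {F : Type v} [NonUnitalCStarAlgebra F] [FiniteDimensional ℂ F] (a : F) :
    a ∈ Submodule.span ℂ {p : F | star p = p ∧ p * p = p} := by
  have key : ∀ a : F, IsSelfAdjoint a → a ∈ Submodule.span ℂ {p : F | star p = p ∧ p * p = p} := by
    intro a ha
    have hfin := aux_quasi_fin a
    have hc : ∀ f : ℝ → ℝ, ContinuousOn f (quasispectrum ℝ a) := fun f => hfin.continuousOn f
    let f : ℝ → ℝ → ℝ := fun l t => if l = 0 then 0 else if t = l then 1 else 0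
    have f0 : ∀ l, f l 0 = 0 := by intro l; simp only [f]; split_ifs <;> simp_all
    have : a = ∑ l ∈ hfin.toFinset, (l : ℂ) • cfcₙ (f l) a := by
      conv_lhs => rw [← cfcₙ_id' ℝ a]
      have : ∀ l : ℝ, ((l:ℂ) • cfcₙ (f l) a) = cfcₙ (fun t => l • f l t) a := by
        intro l
        rw [cfcₙ_smul l (f l) a (hc _) (f0 l)]; simp
      simp_rw [this]
      rw [← cfcₙ_sum _ a _ (fun _ _ => hc _) (fun l _ => by simp [f0 l])]
      apply cfcₙ_congr
      intro t ht
      simp only [Finset.sum_apply]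
      rw [Finset.sum_eq_single t]
      · by_cases h : t = 0 <;> simp [f, h]
      · intro l _ hl; simp [f, hl.symm]
      · intro h; simp at h; exact absurd ht h
    rw [this]
    refine Submodule.sum_mem _ fun l _ => Submodule.smul_mem _ _ (Submodule.subset_span ⟨(cfcₙ_predicate (f l) a : IsSelfAdjoint _), ?_⟩)
    rw [← cfcₙ_mul _ _ a (hc _) (f0 l) (hc _) (f0 l)]
    congr 1; ext t; simp only [f]; split_ifs <;> simp
  rw [← realPart_add_I_smul_imaginaryPart a]
  exact Submodule.add_mem _ (key _ (realPart a).2) (Submodule.smul_mem _ _ (key _ (imaginaryPart a).2))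

def AuxFam {F : Type v} [NonUnitalCStarAlgebra F] (S : Finset F) : Prop :=
  (∀ p ∈ S, p ≠ 0 ∧ star p = p ∧ p * p = p) ∧ ∀ p ∈ S, ∀ q ∈ S, p ≠ q → p * q = 0

theorem aux_fam_card {F : Type v} [NonUnitalCStarAlgebra F] [FiniteDimensional ℂ F]
    (S : Finset F) (h : AuxFam S) : S.card ≤ Module.finrank ℂ F := by
  classical
  have hli : LinearIndependent ℂ (fun p : S => (p : F)) := by
    rw [Fintype.linearIndependent_iff]
    intro g hg i
    have h1 : (∑ j : S, g j • (j : F)) * (i : F) = g i • (i : F) := by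
      rw [Finset.sum_mul, Finset.sum_eq_single i]
      · rw [smul_mul_assoc, (h.1 i i.2).2.2]
      · intro j _ hj
        rw [smul_mul_assoc, h.2 j j.2 i i.2 (fun hh => hj (Subtype.ext hh)), smul_zero]
      · simp
    rw [hg, zero_mul] at h1
    rcases smul_eq_zero.1 h1.symm with h2 | h2
    · exact h2
    · exact absurd h2 (h.1 i i.2).1
  have := hli.fintype_card_le_finrank
  simpa using this

theorem aux_fam_max (F : Type v) [NonUnitalCStarAlgebra F] [FiniteDimensional ℂ F] :
    ∃ S : Finset F, AuxFam S ∧ ∀ S' : Finset F, AuxFam S' → S'.card ≤ S.card := by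
  by_contra! hcon
  have : ∀ n : ℕ, ∃ S : Finset F, AuxFam S ∧ n ≤ S.card := by
    intro n
    induction n with
    | zero => exact ⟨∅, ⟨by simp, by simp⟩, by simp⟩
    | succ n ih =>
      obtain ⟨S, hS, hn⟩ := ih
      obtain ⟨S', hS', hc⟩ := hcon S hS
      exact ⟨S', hS', by omega⟩
  obtain ⟨S, hS, hn⟩ := this (Module.finrank ℂ F + 1)
  have := aux_fam_card S hS
  omega

theorem aux_fam_unit {F : Type v} [NonUnitalCStarAlgebra F] [FiniteDimensional ℂ F]
    {S : Finset F} (hS : AuxFam S) (hmax : ∀ S' : Finset F, AuxFam S' → S'.card ≤ S.card)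
    (a : F) : (∑ p ∈ S, p) * a = a := by
  classical
  by_contra hne
  set b := a - (∑ p ∈ S, p) * a with hb
  have hb0 : b ≠ 0 := fun h => hne (sub_eq_zero.1 h).symm
  have hpb : ∀ p ∈ S, p * b = 0 := by
    intro p hp
    rw [hb, mul_sub, ← mul_assoc, Finset.mul_sum, Finset.sum_eq_single p, (hS.1 p hp).2.2, sub_self]
    · intro q hq hqp; exact hS.2 p hp q hq hqp.symm
    · intro h; exact absurd hp h
  have hbb : b * star b ≠ 0 := by
    intro h; exact hb0 ((CStarRing.mul_star_self_eq_zero_iff b).1 h)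
  obtain ⟨q, l, hl, hq0, hqs, hqq, hq⟩ := aux_proj (IsSelfAdjoint.mul_star_self b) (aux_quasi_fin _) hbb
  have hpq : ∀ p ∈ S, p * q = 0 := by
    intro p hp
    have h1 : p * (b * star b * q) = 0 := by
      rw [← mul_assoc, ← mul_assoc, hpb p hp, zero_mul, zero_mul]
    rw [hq, mul_smul_comm] at h1
    rcases smul_eq_zero.1 h1 with h2 | h2
    · exact absurd (by exact_mod_cast h2) hl
    · exact h2
  have hqp : ∀ p ∈ S, q * p = 0 := by
    intro p hp
    have := congrArg star (hpq p hp)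
    simpa [hqs, (hS.1 p hp).2.1] using this
  have hqS : q ∉ S := fun h => hq0 (by rw [← hqq, hpq q h])
  have hfam : AuxFam (insert q S) := by
    refine ⟨?_, ?_⟩
    · intro p hp
      rcases Finset.mem_insert.1 hp with rfl | hp
      · exact ⟨hq0, hqs, hqq⟩
      · exact hS.1 p hp
    · intro p hp r hr hpr
      rcases Finset.mem_insert.1 hp with hp | hp <;> rcases Finset.mem_insert.1 hr with hr | hr
      · exact absurd (hp.trans hr.symm) hpr
      · rw [hp]; exact hqp r hr
      · rw [hr]; exact hpq p hp
      · exact hS.2 p hp r hr hpr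
  have := hmax _ hfam
  rw [Finset.card_insert_of_notMem hqS] at this
  omega

theorem aux_fam_min {F : Type v} [NonUnitalCStarAlgebra F] [FiniteDimensional ℂ F]
    {S : Finset F} (hS : AuxFam S) (hmax : ∀ S' : Finset F, AuxFam S' → S'.card ≤ S.card)
    (p : F) (hp : p ∈ S) (a : F) : ∃ c : ℂ, p * a * p = c • p := by
  classical
  obtain ⟨hp0, hps, hpp⟩ := hS.1 p hp
  have key : ∀ a : F, IsSelfAdjoint a → ∃ c : ℂ, p * a * p = c • p := by
    intro a ha
    set b := p * a * p with hb
    by_cases hb0 : b = 0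
    · exact ⟨0, by simp [hb0]⟩
    have hbs : IsSelfAdjoint b := by
      rw [IsSelfAdjoint, hb, star_mul, star_mul, hps, ha.star_eq, mul_assoc]
    have hpb : p * b = b := by rw [hb, ← mul_assoc, ← mul_assoc, hpp]
    have hbp : b * p = b := by rw [hb, mul_assoc, hpp]
    obtain ⟨q, l, hl, hq0, hqs, hqq, hq⟩ := aux_proj hbs (aux_quasi_fin _) hb0
    have hlc : (l : ℂ) ≠ 0 := by exact_mod_cast hl
    have hpq : p * q = q := by
      have h1 : p * (b * q) = b * q := by rw [← mul_assoc, hpb]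
      rw [hq, mul_smul_comm] at h1
      exact smul_right_injective F hlc h1
    have hqp : q * p = q := by
      have := congrArg star hpq
      simpa [hqs, hps] using this
    by_cases hqe : q = p
    · refine ⟨l, ?_⟩
      rw [hqe, hbp] at hq
      exact hq
    exfalso
    have hr0 : p - q ≠ 0 := fun h => hqe (sub_eq_zero.1 h).symm
    have horth : ∀ s ∈ S, s ≠ p → s * q = 0 ∧ q * s = 0 ∧ s * p = 0 ∧ p * s = 0 := by
      intro s hs hsp
      have h1 := hS.2 s hs p hp hsp
      have h2 := hS.2 p hp s hs hsp.symm
      refine ⟨?_, ?_, h1, h2⟩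
      · rw [← hpq, ← mul_assoc, h1, zero_mul]
      · rw [← hqp, mul_assoc, h2, mul_zero]
    have hqr : q * (p - q) = 0 := by rw [mul_sub, hqp, hqq, sub_self]
    have hrq : (p - q) * q = 0 := by rw [sub_mul, hpq, hqq, sub_self]
    have hrr : (p - q) * (p - q) = p - q := by rw [mul_sub, hrq, sub_zero, sub_mul, hpp, hqp]
    have hqne : q ≠ p - q := by
      intro h; rw [← h, hqq] at hqr; exact hq0 hqr
    have hqS : q ∉ S.erase p := by
      intro h
      have h1 := horth q (Finset.mem_of_mem_erase h) (Finset.ne_of_mem_erase h)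
      exact hq0 (hqq ▸ h1.1)
    have hrS : p - q ∉ S.erase p := by
      intro h
      have h1 := horth _ (Finset.mem_of_mem_erase h) (Finset.ne_of_mem_erase h)
      have : (p - q) * (p - q) = 0 := by rw [mul_sub, h1.1, h1.2.2.1, sub_zero]
      exact hr0 (hrr ▸ this)
    have hfam : AuxFam (insert q (insert (p - q) (S.erase p))) := by
      refine ⟨?_, ?_⟩
      · intro s hs
        rcases Finset.mem_insert.1 hs with rfl | hs
        · exact ⟨hq0, hqs, hqq⟩
        rcases Finset.mem_insert.1 hs with rfl | hs
        · exact ⟨hr0, by rw [star_sub, hps, hqs], hrr⟩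
        · exact hS.1 s (Finset.mem_of_mem_erase hs)
      · intro s hs t ht hst
        rcases Finset.mem_insert.1 hs with rfl | hs
        · rcases Finset.mem_insert.1 ht with rfl | ht
          · exact absurd rfl hst
          rcases Finset.mem_insert.1 ht with rfl | ht
          · exact hqr
          · exact (horth t (Finset.mem_of_mem_erase ht) (Finset.ne_of_mem_erase ht)).2.1
        rcases Finset.mem_insert.1 hs with rfl | hs
        · rcases Finset.mem_insert.1 ht with rfl | ht
          · exact hrq
          rcases Finset.mem_insert.1 ht with rfl | ht
          · exact absurd rfl hst
          · have := horth t (Finset.mem_of_mem_erase ht) (Finset.ne_of_mem_erase ht)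
            rw [sub_mul, this.2.1, this.2.2.2, sub_zero]
        · have h1 := horth s (Finset.mem_of_mem_erase hs) (Finset.ne_of_mem_erase hs)
          rcases Finset.mem_insert.1 ht with rfl | ht
          · exact h1.1
          rcases Finset.mem_insert.1 ht with rfl | ht
          · rw [mul_sub, h1.1, h1.2.2.1, sub_zero]
          · exact hS.2 s (Finset.mem_of_mem_erase hs) t (Finset.mem_of_mem_erase ht) hst
    have h3 := hmax _ hfam
    rw [Finset.card_insert_of_notMem (by simp only [Finset.mem_insert, not_or]; exact ⟨hqne, hqS⟩),
      Finset.card_insert_of_notMem hrS, Finset.card_erase_of_mem hp] at h3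
    have : 0 < S.card := Finset.card_pos.2 ⟨p, hp⟩
    omega
  obtain ⟨c, hc⟩ := key _ (realPart a).2
  obtain ⟨d, hd⟩ := key _ (imaginaryPart a).2
  refine ⟨c + Complex.I * d, ?_⟩
  conv_lhs => rw [← realPart_add_I_smul_imaginaryPart a]
  rw [mul_add, add_mul, hc, mul_smul_comm, smul_mul_assoc, hd, add_smul, mul_smul]

/-- matrix units of a finite-dimensional C*-algebra -/
theorem aux_struct (F : Type v) [NonUnitalCStarAlgebra F] [FiniteDimensional ℂ F] :
    ∃ (S : Finset F) (e : F → F) (u : F), (∀ a : F, u * a = a ∧ a * u = a) ∧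
      (∀ i ∈ S, ∀ j ∈ S, i ≠ j → star (e i) * e j = 0) ∧
      (∀ i ∈ S, e i * star (e i) * e i = e i) ∧
      (∀ i ∈ S, ∀ j ∈ S, star (e i) * e i = star (e j) * e j ∨ e i * star (e j) = 0) ∧
      ∀ a : F, a ∈ Submodule.span ℂ {w : F | ∃ i ∈ S, ∃ j ∈ S, w = e i * star (e j)} := by
  classical
  obtain ⟨S, hS, hmax⟩ := aux_fam_max F
  have hu1 := aux_fam_unit hS hmax
  have hmin := aux_fam_min hS hmax
  have hus : star (∑ p ∈ S, p) = ∑ p ∈ S, p := by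
    rw [star_sum]; exact Finset.sum_congr rfl fun p hp => (hS.1 p hp).2.1
  have hu2 : ∀ a : F, a * (∑ p ∈ S, p) = a := by
    intro a
    have := congrArg star (hu1 (star a))
    rw [star_mul, star_star, hus] at this
    exact this
  -- Murray von Neumann equivalence
  let R : F → F → Prop := fun p q => q ∈ S ∧ ∃ v : F, v * star v = p ∧ star v * v = q
  have hpi : ∀ p ∈ S, ∀ v : F, v * star v = p → p * v = v := by
    intro p hp v hv
    have h : (p * v - v) * star (p * v - v) = 0 := by
      have e1 : star (p * v - v) = star v * p - star v := by
        rw [star_sub, star_mul, (hS.1 p hp).2.1]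
      have : p * p = p := (hS.1 p hp).2.2
      rw [e1]
      calc (p * v - v) * (star v * p - star v)
          = p * (v * star v) * p - p * (v * star v) - (v * star v) * p + v * star v := by
            noncomm_ring
        _ = 0 := by rw [hv, this, this]; abel
    exact sub_eq_zero.1 ((CStarRing.mul_star_self_eq_zero_iff _).1 h)
  have hpi2 : ∀ p ∈ S, ∀ v : F, star v * v = p → v * p = v := by
    intro p hp v hv
    have := hpi p hp (star v) (by rw [star_star]; exact hv)
    have := congrArg star this
    rwa [star_mul, star_star, (hS.1 p hp).2.1] at this
  have hRrefl : ∀ p ∈ S, R p p := fun p hp => ⟨hp, p, by rw [(hS.1 p hp).2.1, (hS.1 p hp).2.2],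
    by rw [(hS.1 p hp).2.1, (hS.1 p hp).2.2]⟩
  have hRtrans : ∀ p ∈ S, ∀ q ∈ S, ∀ r, R p q → R q r → R p r := by
    rintro p hp q hq r ⟨_, v, hv1, hv2⟩ ⟨hr, w, hw1, hw2⟩
    refine ⟨hr, v * w, ?_, ?_⟩
    · rw [star_mul, mul_assoc, ← mul_assoc w, hw1, ← mul_assoc, hpi2 q hq v hv2, hv1]
    · rw [star_mul, mul_assoc, ← mul_assoc (star v), hv2, hpi q hq w hw1, hw2]
  have hRsymm : ∀ p ∈ S, ∀ q ∈ S, R p q → R q p := by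
    rintro p hp q hq ⟨_, v, hv1, hv2⟩
    exact ⟨hp, star v, by rw [star_star]; exact hv2, by rw [star_star]; exact hv1⟩
  -- off-diagonal corners
  have hoff : ∀ p ∈ S, ∀ q ∈ S, ∀ a : F, p * a * q ≠ 0 → R p q := by
    intro p hp q hq a hne
    obtain ⟨hp0, hps, hpp⟩ := hS.1 p hp
    obtain ⟨hq0, hqs, hqq⟩ := hS.1 q hq
    set c := p * a * q with hc
    have hcs : star c = q * star a * p := by rw [hc, star_mul, star_mul, hps, hqs, mul_assoc]
    obtain ⟨l, hl⟩ := hmin q hq (star a * p * a)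
    obtain ⟨m, hm⟩ := hmin p hp (a * q * star a)
    have hcc : star c * c = l • q := by
      rw [← hl, hcs, hc]
      calc q * star a * p * (p * a * q) = q * star a * (p * p) * a * q := by noncomm_ring
        _ = _ := by rw [hpp]; noncomm_ring
    have hcc' : c * star c = m • p := by
      rw [← hm, hcs, hc]
      calc p * a * q * (q * star a * p) = p * a * (q * q) * star a * p := by noncomm_ring
        _ = _ := by rw [hqq]; noncomm_ring
    have hlr : (starRingEnd ℂ) l = l := by
      have h1 : star (star c * c) = star c * c := by rw [star_mul, star_star]
      rw [hcc, star_smul, hqs] at h1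
      have h2 : (star l - l) • q = 0 := by rw [sub_smul, h1, sub_self]
      rcases smul_eq_zero.1 h2 with h | h
      · exact sub_eq_zero.1 h
      · exact absurd h hq0
    have hlre : l = (l.re : ℂ) := (Complex.conj_eq_iff_re.1 hlr).symm
    have hlpos : 0 < l.re := by
      by_contra hneg
      push Not at hneg
      apply hne
      let _ := CStarAlgebra.spectralOrder F
      have := CStarAlgebra.spectralOrderedRing F
      set s : ℂ := ((Real.sqrt (-l.re) : ℝ) : ℂ) with hs
      have hss : star s * s = -l := by
        rw [hs, hlre]
        simp only [Complex.star_def, Complex.conj_ofReal, Complex.ofReal_re]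
        rw [← Complex.ofReal_mul, Real.mul_self_sqrt (by linarith)]
        simp
      have h1 : star (s • q) * (s • q) = -(star c * c) := by
        rw [star_smul, hqs, smul_mul_smul_comm, hqq, hss, hcc, neg_smul]
      have h2 : 0 ≤ -(star c * c) := h1 ▸ star_mul_self_nonneg (s • q)
      have h3 : star c * c = 0 := le_antisymm (neg_nonneg.1 h2) (star_mul_self_nonneg c)
      exact (CStarRing.star_mul_self_eq_zero_iff c).1 h3
    set s : ℂ := (((Real.sqrt l.re)⁻¹ : ℝ) : ℂ) with hs
    have hsl : star s * s * l = 1 := by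
      rw [hs]
      simp only [Complex.star_def, Complex.conj_ofReal]
      conv_lhs => rw [hlre]
      rw [← Complex.ofReal_mul, ← Complex.ofReal_mul, ← mul_inv, Complex.ofReal_re,
        Real.mul_self_sqrt hlpos.le, inv_mul_cancel₀ hlpos.ne']
      simp
    have hvv : star (s • c) * (s • c) = q := by
      rw [star_smul, smul_mul_smul_comm, hcc, smul_smul, hsl, one_smul]
    refine ⟨hq, s • c, ?_, hvv⟩
    have hvv' : (s • c) * star (s • c) = (s * star s * m) • p := by
      rw [star_smul, smul_mul_smul_comm, hcc', smul_smul]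
    set k := s * star s * m
    have hv0 : (s • c) ≠ 0 := by
      intro h; rw [h] at hvv; simp at hvv; exact hq0 hvv.symm
    have hk0 : k ≠ 0 := by
      intro h; rw [h, zero_smul] at hvv'
      exact hv0 ((CStarRing.mul_star_self_eq_zero_iff _).1 hvv')
    have hcq : (s • c) * q = s • c := by rw [smul_mul_assoc, hc, mul_assoc, hqq]
    have hid : ((s • c) * star (s • c)) * ((s • c) * star (s • c)) = (s • c) * star (s • c) := by
      rw [mul_assoc, ← mul_assoc (star (s • c)), hvv, ← mul_assoc, hcq]
    rw [hvv', smul_mul_smul_comm, hpp] at hid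
    have h5 : (k * k - k) • p = 0 := by rw [sub_smul, hid, sub_self]
    rcases smul_eq_zero.1 h5 with h | h
    · have : k = 1 := by
        have : k * (k - 1) = 0 := by rw [← h]; ring
        rcases mul_eq_zero.1 this with h | h
        · exact absurd h hk0
        · exact sub_eq_zero.1 h
      rw [hvv', this, one_smul]
    · exact absurd h hp0
  let rep : F → F := fun p => Classical.epsilon (fun r => R p r)
  have hrep : ∀ p ∈ S, R p (rep p) := fun p hp =>
    Classical.epsilon_spec (p := fun r => R p r) ⟨p, hRrefl p hp⟩
  have hrepeq : ∀ p ∈ S, ∀ q ∈ S, R p q → rep p = rep q := by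
    intro p hp q hq h
    have : (fun r => R p r) = (fun r => R q r) := by
      ext r
      exact ⟨fun h1 => hRtrans q hq p hp r (hRsymm p hp q hq h) h1, fun h1 => hRtrans p hp q hq r h h1⟩
    simp only [rep, this]
  choose! e he1 he2 using fun p (hp : p ∈ S) => (hrep p hp).2
  have hrS : ∀ p ∈ S, rep p ∈ S := fun p hp => (hrep p hp).1
  refine ⟨S, e, ∑ p ∈ S, p, fun a => ⟨hu1 a, hu2 a⟩, ?_, ?_, ?_, ?_⟩
  · intro i hi j hj hij
    rw [← hpi i hi _ (he1 i hi), ← hpi j hj _ (he1 j hj), star_mul, (hS.1 i hi).2.1, mul_assoc,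
      ← mul_assoc i, hS.2 i hi j hj hij, zero_mul, mul_zero]
  · intro i hi
    rw [he1 i hi, hpi i hi _ (he1 i hi)]
  · intro i hi j hj
    rw [he2 i hi, he2 j hj]
    by_cases h : rep i = rep j
    · exact Or.inl h
    · right
      rw [← hpi2 _ (hrS i hi) _ (he2 i hi), ← hpi2 _ (hrS j hj) _ (he2 j hj), star_mul,
        (hS.1 _ (hrS j hj)).2.1, mul_assoc, ← mul_assoc (rep i), hS.2 _ (hrS i hi) _ (hrS j hj) h,
        zero_mul, mul_zero]
  · intro a
    have : a = ∑ p ∈ S, ∑ q ∈ S, p * a * q := by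
      have h1 : ∀ p ∈ S, ∑ q ∈ S, p * a * q = p * a := fun p _ => by
        rw [← Finset.mul_sum, hu2]
      rw [Finset.sum_congr rfl h1, ← Finset.sum_mul, hu1]
    rw [this]
    refine Submodule.sum_mem _ fun p hp => Submodule.sum_mem _ fun q hq => ?_
    by_cases h0 : p * a * q = 0
    · rw [h0]; exact Submodule.zero_mem _
    have hrr := hrepeq p hp q hq (hoff p hp q hq a h0)
    obtain ⟨c, hc⟩ := hmin (rep p) (hrS p hp) (star (e p) * a * e q)
    have : p * a * q = c • (e p * star (e q)) := by
      have h1 := hpi2 _ (hrS p hp) _ (he2 p hp)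
      have h2 := hpi2 _ (hrS q hq) _ (he2 q hq)
      have h3 : e p * (c • rep p) * star (e q) = c • (e p * star (e q)) := by
        rw [mul_smul_comm, smul_mul_assoc, h1]
      rw [← h3, ← hc]
      have h4 : rep p * star (e q) = star (e q) := by
        rw [hrr]
        have := congrArg star h2
        rwa [star_mul, (hS.1 _ (hrS q hq)).2.1] at this
      calc p * a * q = (e p * star (e p)) * a * (e q * star (e q)) := by rw [he1 p hp, he1 q hq]
        _ = (e p * rep p) * star (e p) * a * e q * (rep p * star (e q)) := by
            rw [h1, h4]; noncomm_ring
        _ = _ := by noncomm_ring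
    rw [this]
    exact Submodule.smul_mem _ _ (Submodule.subset_span ⟨p, hp, q, hq, rfl⟩)

theorem aux_cp_pos {A : Type u} {F : Type v} [NonUnitalCStarAlgebra A] [NonUnitalCStarAlgebra F]
    (θ : F →ₗ[ℂ] A) (hcp : IsCP θ) (a : F) : ∃ z : A, θ (star a * a) = star z * z := by
  obtain ⟨y, hy⟩ := hcp 1 (Matrix.of fun _ _ => star a * a) ⟨Matrix.of fun _ _ => a, by
    ext i j; simp [Matrix.mul_apply, Matrix.star_apply]⟩
  refine ⟨y 0 0, ?_⟩
  have := congrFun (congrFun hy 0) 0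
  simpa [Matrix.mul_apply, Matrix.star_apply] using this

/-- The two by two matrix consequence of complete positivity. -/
theorem aux_cp_two {A : Type u} {F : Type v} [NonUnitalCStarAlgebra A] [NonUnitalCStarAlgebra F]
    (θ : F →ₗ[ℂ] A) (hcp : IsCP θ) (a u : F) :
    ∃ z1 z2 w1 w2 : A, θ (star a * a) = star z1 * z1 + star z2 * z2 ∧
      θ (star u * a) = star w1 * z1 + star w2 * z2 ∧
      θ (star a * u) = star z1 * w1 + star z2 * w2 ∧
      θ (star u * u) = star w1 * w1 + star w2 * w2 := by
  obtain ⟨y, hy⟩ := hcp 2 (star !![a, u; 0, 0] * !![a, u; 0, 0]) ⟨_, rfl⟩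
  have h := fun i j => congrFun (congrFun hy i) j
  refine ⟨y 0 0, y 1 0, y 0 1, y 1 1, ?_, ?_, ?_, ?_⟩
  · simpa [Matrix.mul_apply, Matrix.star_apply, Fin.sum_univ_two] using h 0 0
  · simpa [Matrix.mul_apply, Matrix.star_apply, Fin.sum_univ_two] using h 1 0
  · simpa [Matrix.mul_apply, Matrix.star_apply, Fin.sum_univ_two] using h 0 1
  · simpa [Matrix.mul_apply, Matrix.star_apply, Fin.sum_univ_two] using h 1 1

theorem aux_sum_zero {A : Type u} [NonUnitalCStarAlgebra A] (a b : A)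
    (h : star a * a + star b * b = 0) : a = 0 ∧ b = 0 := by
  let _ := CStarAlgebra.spectralOrder A
  have := CStarAlgebra.spectralOrderedRing A
  have h2 := (add_eq_zero_iff_of_nonneg (star_mul_self_nonneg a) (star_mul_self_nonneg b)).1 h
  exact ⟨(CStarRing.star_mul_self_eq_zero_iff a).1 h2.1,
    (CStarRing.star_mul_self_eq_zero_iff b).1 h2.2⟩

theorem aux_oz {A : Type u} {F : Type v} [NonUnitalCStarAlgebra A] [NonUnitalCStarAlgebra F]
    [FiniteDimensional ℂ F] (θ : F →ₗ[ℂ] A) (hcp : IsCP θ)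
    (hoz : ∀ x y : F, (∃ u, x = star u * u) → (∃ v, y = star v * v) → x * y = 0 →
        θ x * θ y = 0) :
    (∀ a, θ (star a) = star (θ a)) ∧ (∀ a c b, θ (a * c) * θ b = θ a * θ (c * b)) := by
  obtain ⟨S, e, u, hu, -⟩ := aux_struct F
  have hus : star u = u := by
    have := congrArg star (hu (star u)).1
    rw [star_mul, star_star] at this
    rw [← (hu (star u)).1, this]
  have hstar : ∀ a, θ (star a) = star (θ a) := by
    intro a
    obtain ⟨z1, z2, w1, w2, h1, h2, h3, h4⟩ := aux_cp_two θ hcp a u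
    rw [hus, (hu a).1] at h2
    rw [(hu _).2] at h3
    rw [h2, h3]; simp
  have hk1 : ∀ a : F, ∀ y : A, θ (star a * a) * y = 0 → θ a * y = 0 := by
    intro a y hy
    obtain ⟨z1, z2, w1, w2, h1, h2, h3, h4⟩ := aux_cp_two θ hcp a u
    rw [hus, (hu a).1] at h2
    have := aux_sum_zero (z1 * y) (z2 * y) (by
      rw [star_mul, star_mul]
      calc star y * star z1 * (z1 * y) + star y * star z2 * (z2 * y)
          = star y * ((star z1 * z1 + star z2 * z2) * y) := by noncomm_ring
        _ = 0 := by rw [← h1, hy, mul_zero])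
    rw [h2, add_mul, mul_assoc, mul_assoc, this.1, this.2]; simp
  have hzp : ∀ a b : F, a * b = 0 → θ a * θ b = 0 := by
    intro a b hab
    apply hk1
    have h1 := hoz (b * star b) (star a * a) ⟨star b, by simp⟩ ⟨a, rfl⟩ (by
      have := congrArg star hab
      rw [star_mul, star_zero] at this
      rw [mul_assoc, ← mul_assoc (star b), this, zero_mul, mul_zero])
    have h2 := hk1 (star b) (θ (star a * a)) (by rw [star_star]; exact h1)
    rw [hstar] at h2
    have h3 := congrArg star h2
    rw [star_mul, star_star, star_zero, ← hstar, star_mul, star_star] at h3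
    exact h3
  refine ⟨hstar, fun a c b => ?_⟩
  have hc := aux_span_proj c
  induction hc using Submodule.span_induction with
  | mem p hp =>
    have h1 := hzp (a * p) (b - p * b) (by rw [mul_sub, mul_assoc, mul_assoc, ← mul_assoc p p, hp.2, sub_self])
    have h2 := hzp (a - a * p) (p * b) (by rw [sub_mul, mul_assoc a p, ← mul_assoc p p, hp.2, sub_self])
    rw [map_sub, mul_sub, sub_eq_zero] at h1
    rw [map_sub, sub_mul, sub_eq_zero] at h2
    rw [h1, h2]
  | zero => simp
  | add x y _ _ hx hy => rw [mul_add, map_add, add_mul, hx, hy, add_mul, map_add, mul_add]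
  | smul r x _ hx => rw [mul_smul_comm, map_smul, smul_mul_assoc, hx, smul_mul_assoc, map_smul, mul_smul_comm]

section auxOrder
variable {A : Type u} [CStarAlgebra A] [PartialOrder A] [StarOrderedRing A]

theorem aux_inv {S : A} {s : ℝ} (hs : 0 < s) (hS : algebraMap ℝ A s ≤ S) :
    ∃ T : A, IsSelfAdjoint T ∧ S * T = 1 ∧ T * S = 1 ∧ ‖T‖ ≤ s⁻¹ := by
  have hSa : IsSelfAdjoint S := by
    have h0 : (0 : A) ≤ algebraMap ℝ A s := algebraMap_nonneg A hs.le
    exact .of_nonneg (h0.trans hS)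
  have hsp := (algebraMap_le_iff_le_spectrum (a := S) hSa).1 hS
  have hcont : ContinuousOn (fun t : ℝ => t⁻¹) (spectrum ℝ S) := by
    apply ContinuousOn.inv₀ continuousOn_id
    intro t ht; exact (hs.trans_le (hsp t ht)).ne'
  have hmul : S * cfc (fun t : ℝ => t⁻¹) S = 1 := by
    have h1 : S * cfc (fun t : ℝ => t⁻¹) S = cfc (fun t : ℝ => t) S * cfc (fun t : ℝ => t⁻¹) S := by
      rw [cfc_id' ℝ S]
    rw [h1, ← cfc_mul (fun t : ℝ => t) (fun t : ℝ => t⁻¹) S continuousOn_id hcont, ← cfc_const_one ℝ S]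
    apply cfc_congr
    intro t ht
    exact mul_inv_cancel₀ (hs.trans_le (hsp t ht)).ne'
  refine ⟨cfc (fun t : ℝ => t⁻¹) S, cfc_predicate _ S, hmul, ?_, ?_⟩
  · have := congrArg star hmul
    rw [star_mul, hSa.star_eq, (cfc_predicate (fun t : ℝ => t⁻¹) S : IsSelfAdjoint _).star_eq,
      star_one] at this
    exact this
  · apply norm_cfc_le (by positivity)
    intro t ht
    have := hsp t ht
    rw [Real.norm_of_nonneg (by have := hs.trans_le this; positivity)]
    exact inv_anti₀ hs this

theorem aux_norm_le {a : A} (ha : IsSelfAdjoint a) {r : ℝ} (hr : 0 ≤ r) (h1 : -algebraMap ℝ A r ≤ a)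
    (h2 : a ≤ algebraMap ℝ A r) : ‖a‖ ≤ r := by
  rw [← cfc_id' ℝ a]
  apply norm_cfc_le hr
  intro t ht
  have e1 := (algebraMap_le_iff_le_spectrum (r := -r) ha).1 (by rw [map_neg]; exact h1) t ht
  have e2 := (le_algebraMap_iff_spectrum_le (r := r) ha).1 h2 t ht
  exact abs_le.2 ⟨e1, e2⟩

theorem aux_sqrt_le {k l : A} (hk : 0 ≤ k) (hl : 0 ≤ l) {w : ℝ} (hw : 0 ≤ w)
    (h : ‖k * k - l * l‖ ≤ w ^ 2) : k ≤ l + algebraMap ℝ A w := by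
  have hks : IsSelfAdjoint k := .of_nonneg hk
  have hls : IsSelfAdjoint l := .of_nonneg hl
  have hw0 : (0 : A) ≤ algebraMap ℝ A w := algebraMap_nonneg A hw
  have hsa : IsSelfAdjoint (k * k - l * l) := by
    rw [IsSelfAdjoint, star_sub, star_mul, star_mul, hks.star_eq, hls.star_eq]
  have h1 : k * k - l * l ≤ algebraMap ℝ A (w ^ 2) :=
    hsa.le_algebraMap_norm_self.trans (algebraMap_mono A h)
  have h2 : k * k ≤ (l + algebraMap ℝ A w) * (l + algebraMap ℝ A w) := by
    have e : (l + algebraMap ℝ A w) * (l + algebraMap ℝ A w)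
        = l * l + algebraMap ℝ A (w ^ 2) + (2 * w) • l := by
      simp only [Algebra.algebraMap_eq_smul_one, add_mul, mul_add, smul_mul_assoc, mul_smul_comm,
        one_mul, mul_one, smul_smul]
      module
    rw [e]
    have e2 : 0 ≤ (2 * w) • l := smul_nonneg (by positivity) hl
    have e3 : k * k ≤ l * l + algebraMap ℝ A (w ^ 2) := by
      rw [sub_le_iff_le_add] at h1; rwa [add_comm]
    exact e3.trans (le_add_of_nonneg_right e2)
  have h3 := CFC.sqrt_le_sqrt _ _ h2
  rwa [CFC.sqrt_mul_self k hk, CFC.sqrt_mul_self _ (add_nonneg hl hw0)] at h3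

theorem aux_sqrt_norm {k l : A} (hk : 0 ≤ k) (hl : 0 ≤ l) {w : ℝ} (hw : 0 ≤ w)
    (h : ‖k * k - l * l‖ ≤ w ^ 2) : ‖k - l‖ ≤ w := by
  apply aux_norm_le ((IsSelfAdjoint.of_nonneg hk).sub (.of_nonneg hl)) hw
  · have := aux_sqrt_le hl hk hw (by rw [norm_sub_rev]; exact h)
    rw [neg_le, neg_sub, sub_le_iff_le_add, add_comm]; exact this
  · have := aux_sqrt_le hk hl hw h
    rw [sub_le_iff_le_add, add_comm]; exact this

end auxOrder

theorem aux_rr_core {A : Type u} [CStarAlgebra A] [PartialOrder A] [StarOrderedRing A]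
    {x b : A} (hx : 0 ≤ x) (hx1 : ‖x‖ ≤ 1) {s : ℝ} (hs : 0 < s) (hs1 : s ≤ 1 / 10)
    (hb : IsSelfAdjoint b) (hfin : (spectrum ℝ b).Finite) (hxb : ‖x - b‖ < s ^ 8) :
    ∃ (G : Set A) (m : A), G.Finite ∧ 0 ∈ G ∧ (∀ g ∈ G, ∀ g' ∈ G, g * g' ∈ G) ∧
      (∀ g ∈ G, star g ∈ G) ∧ (∀ g ∈ G, (star m * (x * x) * m) * g = g) ∧
      ∃ c ∈ Submodule.span ℂ G, ‖x * (m * c * star m) * x - x‖ ≤ 10 * s := by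
  have hxs : IsSelfAdjoint x := .of_nonneg hx
  have hc : ∀ f : ℝ → ℝ, ContinuousOn f (spectrum ℝ b) := fun f => hfin.continuousOn f
  have hmul : ∀ f g : ℝ → ℝ, cfc f b * cfc g b = cfc (fun t => f t * g t) b :=
    fun f g => (cfc_mul f g b (hc _) (hc _)).symm
  have hsa : ∀ f : ℝ → ℝ, star (cfc f b) = cfc f b := fun f =>
    (cfc_predicate f b : IsSelfAdjoint _)
  have hs8 : 0 < s ^ 8 := by positivity
  have hs8' : s ^ 8 ≤ s := by
    calc s ^ 8 ≤ s ^ 1 := pow_le_pow_of_le_one hs.le (by linarith) (by norm_num)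
      _ = s := pow_one s
  have hb1 : ‖b‖ ≤ 1 + s ^ 8 := by
    have : b = x - (x - b) := by abel
    rw [this]
    exact (norm_sub_le _ _).trans (by linarith)
  have hspec : ∀ t ∈ spectrum ℝ b, -s ≤ t := by
    apply (algebraMap_le_iff_le_spectrum (r := -s) hb).1
    have h1 : x - b ≤ algebraMap ℝ A s :=
      (hxs.sub hb).le_algebraMap_norm_self.trans (algebraMap_mono A (by linarith))
    rw [map_neg, neg_le]
    calc -b ≤ x - b := by rw [sub_eq_add_neg]; exact le_add_of_nonneg_left hx
      _ ≤ _ := h1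
  set q := cfc (fun t : ℝ => if s < t then (1 : ℝ) else 0) b with hq
  set k := cfc (fun t : ℝ => if s < t then t else 1) b with hk
  set k' := cfc (fun t : ℝ => if s < t then t⁻¹ else 1) b with hk'
  set c := cfc (fun t : ℝ => if s < t then t else 0) b with hcdef
  let Q : ℝ → A := fun l => cfc (fun t : ℝ => if t = l then (1 : ℝ) else 0) b
  have hqq : q * q = q := by rw [hq, hmul]; congr 1; ext t; split_ifs <;> simp
  have hqs : star q = q := hsa _
  have hqn : ‖q‖ ≤ 1 := by
    apply norm_cfc_le zero_le_one; intro t ht; split_ifs <;> simp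
  have hqc : q * c = c := by rw [hq, hcdef, hmul]; congr 1; ext t; split_ifs <;> simp
  have hcq : c * q = c := by rw [hq, hcdef, hmul]; congr 1; ext t; split_ifs <;> simp
  have hkc : k = c + (1 - q) := by
    rw [hk, hcdef, hq, ← cfc_one ℝ b, ← cfc_sub _ _ b (hc _) (hc _), ← cfc_add b _ _ (hc _) (hc _)]
    congr 1; ext t; simp only [Pi.one_apply]; split_ifs <;> simp
  have hbq : b * q = c := by
    have : b * q = cfc (fun t : ℝ => t) b * q := by rw [cfc_id' ℝ b]
    rw [this, hq, hmul, hcdef]; congr 1; ext t; split_ifs <;> simp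
  have hqb : q * b = c := by
    have := congrArg star hbq
    rwa [star_mul, hb.star_eq, hqs, hsa] at this
  have hkk' : k * k' = 1 := by
    rw [hk, hk', hmul, ← cfc_const_one ℝ b]; congr 1; ext t; split_ifs with h
    · exact mul_inv_cancel₀ (hs.trans h).ne'
    · simp
  have hk'n : ‖k'‖ ≤ s⁻¹ := by
    apply norm_cfc_le (by positivity); intro t ht; split_ifs with h
    · rw [Real.norm_of_nonneg (by have := hs.trans h; positivity)]
      exact inv_anti₀ hs h.le
    · simp only [norm_one]; exact (one_le_inv₀ hs).2 (by linarith)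
  have hks : algebraMap ℝ A s ≤ k := by
    apply algebraMap_le_cfc _ _ b _ (hc _) hb
    intro t ht
    split_ifs with h
    · exact h.le
    · linarith
  have hs0 : (0 : A) ≤ algebraMap ℝ A s := algebraMap_nonneg A hs.le
  have hk0 : 0 ≤ k := hs0.trans hks
  have hqk' : b * (q * k') * b = c := by
    have : q * k' * b = q := by
      have : q * k' * b = q * k' * cfc (fun t : ℝ => t) b := by rw [cfc_id' ℝ b]
      rw [this, hq, hk', hmul, hmul]; congr 1; ext t; split_ifs with h
      · rw [one_mul]; exact inv_mul_cancel₀ (hs.trans h).ne'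
      · simp
    rw [mul_assoc, this, hbq]
  have hcb : ‖c - b‖ ≤ s := by
    have : c - b = c - cfc (fun t : ℝ => t) b := by rw [cfc_id' ℝ b]
    rw [this, hcdef, ← cfc_sub _ _ b (hc _) (hc _)]
    apply norm_cfc_le hs.le; intro t ht
    split_ifs with h
    · simpa using hs.le
    · rw [zero_sub, norm_neg, Real.norm_eq_abs, abs_le]
      exact ⟨hspec t ht, not_lt.1 h⟩
  -- the element R
  set R := q * (x * x) * q + (1 - q) with hR
  have h1q : star (1 - q) * (1 - q) = 1 - q := by
    rw [star_sub, star_one, hqs, mul_sub, sub_mul, sub_mul, hqq]; simp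
  have hR0 : 0 ≤ R := by
    apply add_nonneg
    · have : q * (x * x) * q = star (x * q) * (x * q) := by
        rw [star_mul, hqs, hxs.star_eq]; noncomm_ring
      rw [this]; exact star_mul_self_nonneg _
    · rw [← h1q]; exact star_mul_self_nonneg _
  have hqR : q * R = q * (x * x) * q := by
    rw [hR, mul_add, mul_sub, mul_one, hqq, sub_self, add_zero, ← mul_assoc, ← mul_assoc, hqq]
  have hRq : R * q = q * (x * x) * q := by
    rw [hR, add_mul, sub_mul, one_mul, hqq, sub_self, add_zero, mul_assoc, hqq]
  have hkk : k * k = q * (b * b) * q + (1 - q) := by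
    have e1 : q * (b * b) * q = c * c := by
      rw [← mul_assoc, hqb, mul_assoc, hbq]
    rw [e1, hkc, add_mul, mul_add, mul_add, mul_sub c, mul_one, hcq, sub_self, sub_mul 1 q c, hqc, one_mul,
      sub_self, add_zero, zero_add]
    congr 1
    rw [mul_sub, sub_mul, sub_mul, hqq]; simp
  have hxxbb : ‖x * x - b * b‖ ≤ 3 * s ^ 8 := by
    have e : x * x - b * b = x * (x - b) + (x - b) * b := by noncomm_ring
    rw [e]
    calc _ ≤ ‖x‖ * ‖x - b‖ + ‖x - b‖ * ‖b‖ :=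
          (norm_add_le _ _).trans (add_le_add (norm_mul_le _ _) (norm_mul_le _ _))
      _ ≤ 1 * s ^ 8 + s ^ 8 * 2 := by
          gcongr
          linarith
      _ = _ := by ring
  have hRk : ‖R - k * k‖ ≤ (2 * s ^ 4) ^ 2 := by
    have e : R - k * k = q * (x * x - b * b) * q := by
      rw [hkk, hR]; noncomm_ring
    rw [e]
    calc _ ≤ ‖q‖ * ‖x * x - b * b‖ * ‖q‖ :=
          (norm_mul_le _ _).trans (mul_le_mul_of_nonneg_right (norm_mul_le _ _) (norm_nonneg _))
      _ ≤ 1 * (3 * s ^ 8) * 1 := by gcongr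
      _ ≤ _ := by nlinarith
  set S := CFC.sqrt R with hS
  have hS0 : 0 ≤ S := CFC.sqrt_nonneg R
  have hSS : S * S = R := CFC.sqrt_mul_sqrt_self R hR0
  have hw0 : (0 : ℝ) ≤ 2 * s ^ 4 := by positivity
  have hs4 : 2 * s ^ 4 ≤ s / 2 := by
    have : s ^ 3 ≤ (1 / 10) ^ 3 := by gcongr
    nlinarith
  have hkS : ‖k - S‖ ≤ 2 * s ^ 4 :=
    aux_sqrt_norm hk0 hS0 hw0 (by rw [hSS, norm_sub_rev]; exact hRk)
  have hSlow : algebraMap ℝ A (s / 2) ≤ S := by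
    have h1 := aux_sqrt_le hk0 hS0 hw0 (by rw [hSS, norm_sub_rev]; exact hRk)
    have h2 : algebraMap ℝ A s ≤ S + algebraMap ℝ A (s / 2) :=
      hks.trans (h1.trans (add_le_add_right (algebraMap_mono A hs4) S))
    rw [← sub_le_iff_le_add, ← map_sub] at h2
    have : s - s / 2 = s / 2 := by ring
    rwa [this] at h2
  obtain ⟨T, hTs, hST, hTS, hTn⟩ := aux_inv (by positivity) hSlow
  have hqS : q * S = S * q := by
    have : Commute R q := by rw [Commute, SemiconjBy, hRq, hqR]
    exact (this.cfcₙ_nnreal _).symm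
  have hqT : q * T = T * q := by
    calc q * T = T * S * (q * T) := by rw [hTS, one_mul]
      _ = T * (S * q) * T := by noncomm_ring
      _ = T * q * (S * T) := by rw [← hqS]; noncomm_ring
      _ = T * q := by rw [hST, mul_one]
  have hstarm : star (q * T) = T * q := by rw [star_mul, hqs, hTs.star_eq]
  have hmm : star (q * T) * (x * x) * (q * T) = q := by
    rw [hstarm]
    calc T * q * (x * x) * (q * T) = T * (q * (x * x) * q) * T := by noncomm_ring
      _ = T * (R * q) * T := by rw [hRq]
      _ = (T * S) * (S * (q * T)) := by rw [← hSS]; noncomm_ring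
      _ = S * (T * q) := by rw [hTS, one_mul, hqT]
      _ = q := by rw [← mul_assoc, hST, one_mul]
  have hQmul : ∀ l l', Q l * Q l' = if l = l' then Q l else 0 := by
    intro l l'
    simp only [Q]
    rw [hmul]
    split_ifs with h
    · subst h; congr 1; ext t; split_ifs <;> simp
    · rw [← cfc_const_zero ℝ b]; congr 1; ext t
      split_ifs with h1 h2
      · exact absurd (h1.symm.trans h2) h
      all_goals simp
  refine ⟨insert 0 (Q '' {l | l ∈ spectrum ℝ b ∧ s < l}), q * T, ?_, Set.mem_insert _ _, ?_, ?_, ?_,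
    c, ?_, ?_⟩
  · exact ((hfin.subset fun l hl => hl.1).image Q).insert 0
  · rintro g (rfl | ⟨l, hl, rfl⟩) g' (rfl | ⟨l', hl', rfl⟩)
    · simp
    · simp
    · simp
    · rw [hQmul]
      split_ifs
      · exact Or.inr ⟨l, hl, rfl⟩
      · exact Or.inl rfl
  · rintro g (rfl | ⟨l, hl, rfl⟩)
    · simp
    · rw [hsa]; exact Or.inr ⟨l, hl, rfl⟩
  · rintro g (rfl | ⟨l, hl, rfl⟩)
    · simp
    · rw [hmm]
      simp only [Q]
      rw [hq, hmul]; congr 1; ext t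
      by_cases h : t = l
      · subst h; simp [hl.2]
      · simp [h]
  · have : c = ∑ l ∈ hfin.toFinset.filter (fun l => s < l), ((l : ℝ) : ℂ) • Q l := by
      have h2 : ∀ l : ℝ, ((l : ℂ) • Q l) = cfc (fun t => l • (if t = l then (1 : ℝ) else 0)) b := by
        intro l
        rw [cfc_smul l _ b (hc _)]; simp [Q]
      simp_rw [h2]
      rw [← cfc_sum _ b _ (fun _ _ => hc _), hcdef]
      apply cfc_congr
      intro t ht
      simp only [Finset.sum_apply]
      by_cases h : s < t
      · rw [Finset.sum_eq_single t]
        · simp [h]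
        · intro l _ hl; simp [hl.symm]
        · intro h3; simp [ht, h] at h3
      · rw [Finset.sum_eq_zero]
        · simp [h]
        · intro l hl
          have : t ≠ l := by rintro rfl; exact h (Finset.mem_filter.1 hl).2
          simp [this]
    rw [this]
    refine Submodule.sum_mem _ fun l hl => Submodule.smul_mem _ _ (Submodule.subset_span (Or.inr ⟨l, ?_, rfl⟩))
    simpa using hl
  · rw [hstarm]
    have e1 : q * T * c * (T * q) - q * k' = q * (T * (k - S) * T) * q + q * (T * (k - S) * k') := by
      have f1 : q * T * c * (T * q) = q * (T * k * T) * q := by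
        have : q * T * (1 - q) = 0 := by rw [hqT, mul_sub, mul_one, mul_assoc, hqq, sub_self]
        have f2 : q * T * c = q * T * k := by rw [hkc, mul_add, this, add_zero]
        rw [f2]; noncomm_ring
      have f3 : q * (T * (k - S) * T) * q = q * (T * k * T) * q - q * T := by
        calc q * (T * (k - S) * T) * q = q * (T * k * T) * q - q * T * (S * T) * q := by noncomm_ring
          _ = _ := by rw [hST, mul_one, hqT, mul_assoc T q q, hqq]
      have f4 : q * (T * (k - S) * k') = q * T - q * k' := by
        calc q * (T * (k - S) * k') = q * T * (k * k') - q * (T * S) * k' := by noncomm_ring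
          _ = _ := by rw [hkk', hTS, mul_one, mul_one]
      rw [f1, f3, f4]; abel
    have hTn' : ‖T‖ ≤ 2 * s⁻¹ := by
      refine hTn.trans (le_of_eq ?_); field_simp
    have hsi : s⁻¹ * s = 1 := inv_mul_cancel₀ hs.ne'
    have hsi0 : 0 < s⁻¹ := by positivity
    have n1 : ‖q * T * c * (T * q) - q * k'‖ ≤ 12 * s ^ 2 := by
      rw [e1]
      have a1 : ‖q * (T * (k - S) * T) * q‖ ≤ 1 * ((2 * s⁻¹) * (2 * s ^ 4) * (2 * s⁻¹)) * 1 :=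
        norm_mul_le_of_le (norm_mul_le_of_le hqn
          (norm_mul_le_of_le (norm_mul_le_of_le hTn' hkS) hTn')) hqn
      have a2 : ‖q * (T * (k - S) * k')‖ ≤ 1 * ((2 * s⁻¹) * (2 * s ^ 4) * s⁻¹) :=
        norm_mul_le_of_le hqn (norm_mul_le_of_le (norm_mul_le_of_le hTn' hkS) hk'n)
      refine (norm_add_le_of_le a1 a2).trans (le_of_eq ?_)
      field_simp
      ring
    have n2 : ‖x * (q * k') * x - c‖ ≤ 3 * s ^ 7 := by
      have e2 : x * (q * k') * x - c = (x - b) * (q * k') * x + b * (q * k') * (x - b) := by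
        rw [← hqk']; noncomm_ring
      rw [e2]
      have a0 : ‖q * k'‖ ≤ 1 * s⁻¹ := norm_mul_le_of_le hqn hk'n
      have a1 : ‖(x - b) * (q * k') * x‖ ≤ s ^ 8 * (1 * s⁻¹) * 1 :=
        norm_mul_le_of_le (norm_mul_le_of_le hxb.le a0) hx1
      have a2 : ‖b * (q * k') * (x - b)‖ ≤ 2 * (1 * s⁻¹) * s ^ 8 :=
        norm_mul_le_of_le (norm_mul_le_of_le (hb1.trans (by linarith)) a0) hxb.le
      refine (norm_add_le_of_le a1 a2).trans (le_of_eq ?_)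
      field_simp
      ring
    have e3 : x * (q * T * c * (T * q)) * x - x = x * (q * T * c * (T * q) - q * k') * x
        + (x * (q * k') * x - c) + (c - b) + (b - x) := by noncomm_ring
    rw [e3]
    have n3 : ‖x * (q * T * c * (T * q) - q * k') * x‖ ≤ 1 * (12 * s ^ 2) * 1 :=
      norm_mul_le_of_le (norm_mul_le_of_le hx1 n1) hx1
    have n4 : ‖b - x‖ ≤ s := by rw [norm_sub_rev]; linarith
    refine (norm_add_le_of_le (norm_add_le_of_le (norm_add_le_of_le n3 n2) hcb) n4).trans ?_
    have p1 : s ^ 2 ≤ s * (1 / 10) := by rw [pow_two]; gcongr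
    have p2 : s ^ 7 ≤ s := by
      calc s ^ 7 ≤ s ^ 1 := pow_le_pow_of_le_one hs.le (by linarith) (by norm_num)
        _ = s := pow_one s
    linarith

theorem aux_rr {A : Type u} [CStarAlgebra A] (hrr : RealRankZero A)
    {x : A} (hx : ∃ z, x = star z * z) (hx1 : ‖x‖ ≤ 1) {η : ℝ} (hη : 0 < η) :
    ∃ (G : Set A) (m : A), G.Finite ∧ 0 ∈ G ∧ (∀ g ∈ G, ∀ g' ∈ G, g * g' ∈ G) ∧
      (∀ g ∈ G, star g ∈ G) ∧ (∀ g ∈ G, (star m * (x * x) * m) * g = g) ∧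
      ∃ c ∈ Submodule.span ℂ G, ‖x * (m * c * star m) * x - x‖ ≤ η := by
  let _ := CStarAlgebra.spectralOrder A
  have := CStarAlgebra.spectralOrderedRing A
  have hx0 : 0 ≤ x := by obtain ⟨z, rfl⟩ := hx; exact star_mul_self_nonneg z
  set s := min (1 / 10) (η / 10) with hs
  have hs0 : 0 < s := lt_min (by norm_num) (by positivity)
  obtain ⟨b, hb, hfin, hxb⟩ := hrr x (.of_nonneg hx0) (s ^ 8) (by positivity)
  obtain ⟨G, m, h1, h2, h3, h4, h5, c, hc, h6⟩ :=
    aux_rr_core hx0 hx1 hs0 (min_le_left _ _) hb hfin hxb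
  refine ⟨G, m, h1, h2, h3, h4, h5, c, hc, h6.trans ?_⟩
  have : s ≤ η / 10 := min_le_right _ _
  linarith

theorem aux_resolvent {A : Type u} [CStarAlgebra A] {x : A} (hx : ∃ z, x = star z * z)
    {η : ℝ} (hη : 0 < η) :
    ∃ T : A, star T = T ∧ x * T + (η : ℂ) • T = 1 ∧ T * x + (η : ℂ) • T = 1 ∧
      ‖T * x‖ ≤ 1 := by
  let _ := CStarAlgebra.spectralOrder A
  have := CStarAlgebra.spectralOrderedRing A
  have hx0 : 0 ≤ x := by obtain ⟨z, rfl⟩ := hx; exact star_mul_self_nonneg z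
  have hxs : IsSelfAdjoint x := .of_nonneg hx0
  have hsp : ∀ t ∈ spectrum ℝ x, 0 ≤ t := fun t ht => spectrum_nonneg_of_nonneg hx0 ht
  have hc : ContinuousOn (fun t : ℝ => (t + η)⁻¹) (spectrum ℝ x) := by
    apply ContinuousOn.inv₀ (by fun_prop)
    intro t ht; have := hsp t ht; positivity
  have hTx : cfc (fun t : ℝ => (t + η)⁻¹) x * x = cfc (fun t : ℝ => (t + η)⁻¹ * t) x := by
    conv_lhs => rw [← cfc_id' ℝ x]
    rw [cfc_id' ℝ x]
    nth_rw 2 [← cfc_id' ℝ x]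
    rw [← cfc_mul _ _ x hc (by fun_prop)]
  have hxT : x * cfc (fun t : ℝ => (t + η)⁻¹) x = cfc (fun t : ℝ => (t + η)⁻¹ * t) x := by
    rw [← hTx]
    exact (cfc_commute_cfc (fun t : ℝ => t) (fun t : ℝ => (t + η)⁻¹) x).eq |> fun h => by
      rwa [cfc_id' ℝ x] at h
  have h1 : cfc (fun t : ℝ => (t + η)⁻¹ * t) x + (η : ℂ) • cfc (fun t : ℝ => (t + η)⁻¹) x = 1 := by
    have : (η : ℂ) • cfc (fun t : ℝ => (t + η)⁻¹) x = cfc (fun t : ℝ => η • (t + η)⁻¹) x := by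
      rw [cfc_smul η _ x hc]; simp
    have h3 : ContinuousOn (fun t : ℝ => (t + η)⁻¹ * t) (spectrum ℝ x) := hc.mul continuousOn_id
    have h4 : ContinuousOn (fun t : ℝ => η • (t + η)⁻¹) (spectrum ℝ x) := hc.const_smul η
    rw [this, ← cfc_add x _ _ h3 h4, ← cfc_const_one ℝ x]
    apply cfc_congr
    intro t ht
    have := hsp t ht
    have h2 : t + η ≠ 0 := by positivity
    simp only [smul_eq_mul]
    field_simp
  refine ⟨cfc (fun t : ℝ => (t + η)⁻¹) x, (cfc_predicate _ x : IsSelfAdjoint _), ?_, ?_, ?_⟩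
  · rw [hxT, h1]
  · rw [hTx, h1]
  · rw [hTx]
    apply norm_cfc_le zero_le_one
    intro t ht
    have := hsp t ht
    rw [Real.norm_of_nonneg (by positivity), inv_mul_le_iff₀ (by positivity)]
    linarith

theorem aux_star_norm {A : Type u} [NonUnitalCStarAlgebra A] {a b : A}
    (h : star a * a = star b * b) : ‖a‖ = ‖b‖ := by
  have h1 := CStarRing.norm_star_mul_self (x := a)
  have h2 := CStarRing.norm_star_mul_self (x := b)
  rw [h, h2] at h1
  nlinarith [norm_nonneg a, norm_nonneg b]

theorem aux_approx {A : Type u} [CStarAlgebra A] {x g a b w Z : A} (hx : ∃ z, x = star z * z)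
    (hg : ∃ z, g = star z * z) (h1 : star a * a = x * x) (h2 : b * star b = x * x)
    (h3 : a * x = g * a) (h4 : a * b = g * w) (h5 : w * star w = g * g) {η : ℝ} (hη : 0 < η)
    (hZ : ‖x * Z * x - x‖ ≤ η) : ‖w - a * Z * b‖ ≤ 3 * η := by
  have hxs : star x = x := by obtain ⟨z, rfl⟩ := hx; simp
  have hgs : star g = g := by obtain ⟨z, rfl⟩ := hg; simp
  obtain ⟨T, hT, hT1, hT2, hT3⟩ := aux_resolvent hx hη
  obtain ⟨U, hU, hU1, hU2, hU3⟩ := aux_resolvent hg hη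
  have hn : ‖(η : ℂ)‖ = η := by simp [abs_of_pos hη]
  have hTU : a * T = U * a := by
    calc a * T = (U * g + (η : ℂ) • U) * (a * T) := by rw [hU2, one_mul]
      _ = U * (g * a * T + (η : ℂ) • (a * T)) := by
        simp only [add_mul, mul_add, smul_mul_assoc, mul_smul_comm, mul_assoc]
      _ = U * (a * (x * T + (η : ℂ) • T)) := by
        rw [← h3]; simp only [mul_add, mul_smul_comm, mul_assoc]
      _ = U * a := by rw [hT1, mul_one]
  have e1 : w - a * T * b = (η : ℂ) • (U * w) := by
    rw [hTU, mul_assoc, h4, ← mul_assoc, ← smul_mul_assoc, sub_eq_iff_eq_add, ← add_mul, add_comm, hU2,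
      one_mul]
  have n1 : ‖U * w‖ ≤ 1 := by
    have : ‖star (U * w)‖ = ‖star (U * g)‖ := by
      apply aux_star_norm
      simp only [star_mul, star_star, hU, hgs]
      calc U * w * (star w * U) = U * (w * star w) * U := by noncomm_ring
        _ = _ := by rw [h5]; noncomm_ring
    rw [norm_star, norm_star] at this
    rw [this]; exact hU3
  have n2 : ‖w - a * T * b‖ ≤ η := by
    rw [e1, norm_smul, hn]; nlinarith
  have key : ∀ Y : A, ‖a * Y * b‖ = ‖x * Y * x‖ := by
    intro Y
    have k1 : ‖a * Y * b‖ = ‖x * Y * b‖ := by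
      apply aux_star_norm
      simp only [star_mul, hxs]
      calc star b * (star Y * star a) * (a * Y * b) = star b * star Y * (star a * a) * Y * b := by
            noncomm_ring
        _ = _ := by rw [h1]; noncomm_ring
    have k2 : ‖star (x * Y * b)‖ = ‖star (x * Y * x)‖ := by
      apply aux_star_norm
      simp only [star_mul, star_star, hxs]
      calc x * Y * b * (star b * (star Y * x)) = x * Y * (b * star b) * star Y * x := by
            noncomm_ring
        _ = _ := by rw [h2]; noncomm_ring
    rw [norm_star, norm_star] at k2
    rw [k1, k2]
  have n3 : ‖x - x * T * x‖ ≤ η := by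
    have : x - x * T * x = (η : ℂ) • (T * x) := by
      rw [← smul_mul_assoc, sub_eq_iff_eq_add, ← add_mul, add_comm, hT1, one_mul]
    rw [this, norm_smul, hn]; nlinarith
  have n4 : ‖x * (T - Z) * x‖ ≤ 2 * η := by
    have : x * (T - Z) * x = -(x - x * T * x) - (x * Z * x - x) := by noncomm_ring
    rw [this]
    refine (norm_sub_le _ _).trans ?_
    rw [norm_neg]; linarith
  have e2 : w - a * Z * b = (w - a * T * b) + a * (T - Z) * b := by noncomm_ring
  rw [e2]
  refine (norm_add_le _ _).trans ?_
  rw [key]; linarith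

theorem aux_subalg {A : Type u} [NonUnitalCStarAlgebra A] (S : Set A) (hS : S.Finite)
    (hm : ∀ a ∈ S, ∀ b ∈ S, a * b ∈ S) (hs : ∀ a ∈ S, star a ∈ S) :
    ∃ C : NonUnitalStarSubalgebra ℂ A, FiniteDimensional ℂ C ∧
      ∀ a, a ∈ C ↔ a ∈ Submodule.span ℂ S := by
  have hmul : ∀ a ∈ Submodule.span ℂ S, ∀ b ∈ Submodule.span ℂ S, a * b ∈ Submodule.span ℂ S := by
    intro a ha b hb
    induction ha using Submodule.span_induction with
    | mem a ha =>
      induction hb using Submodule.span_induction with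
      | mem b hb => exact Submodule.subset_span (hm a ha b hb)
      | zero => rw [mul_zero]; exact zero_mem _
      | add b c _ _ h1 h2 => rw [mul_add]; exact add_mem h1 h2
      | smul r b _ h => rw [mul_smul_comm]; exact Submodule.smul_mem _ _ h
    | zero => rw [zero_mul]; exact zero_mem _
    | add b c _ _ h1 h2 => rw [add_mul]; exact add_mem h1 h2
    | smul r b _ h => rw [smul_mul_assoc]; exact Submodule.smul_mem _ _ h
  have hstar : ∀ a ∈ Submodule.span ℂ S, star a ∈ Submodule.span ℂ S := by
    intro a ha
    induction ha using Submodule.span_induction with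
    | mem a ha => exact Submodule.subset_span (hs a ha)
    | zero => rw [star_zero]; exact zero_mem _
    | add b c _ _ h1 h2 => rw [star_add]; exact add_mem h1 h2
    | smul r b _ h => rw [star_smul]; exact Submodule.smul_mem _ _ h
  let C : NonUnitalStarSubalgebra ℂ A :=
    { Submodule.span ℂ S with
      mul_mem' := fun {a b} ha hb => hmul a ha b hb
      star_mem' := fun {a} ha => hstar a ha }
  refine ⟨C, ?_, fun a => Iff.rfl⟩
  have : FiniteDimensional ℂ (Submodule.span ℂ S) := FiniteDimensional.span_of_finite ℂ hS
  exact this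

theorem aux_oz_image {A : Type u} {F : Type v} [CStarAlgebra A] [NonUnitalCStarAlgebra F]
    [FiniteDimensional ℂ F] (hrr : RealRankZero A) (θ : F →ₗ[ℂ] A) (hcp : IsCP θ)
    (hn : ∀ a, ‖θ a‖ ≤ ‖a‖)
    (hoz : ∀ x y : F, (∃ u, x = star u * u) → (∃ v, y = star v * v) → x * y = 0 →
        θ x * θ y = 0) (Y : Finset F) {ε : ℝ} (hε : 0 < ε) :
    ∃ C : NonUnitalStarSubalgebra ℂ A, FiniteDimensional ℂ C ∧
      ∀ a ∈ Y, MemEps ε (C : Set A) (θ a) := by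
  obtain ⟨hst, hm⟩ := aux_oz θ hcp hoz
  obtain ⟨S, e, u, -, h1, h2, h3, h4⟩ := aux_struct F
  have h2' : ∀ i ∈ S, star (e i) * e i * star (e i) = star (e i) := by
    intro i hi
    have := congrArg star (h2 i hi)
    simpa [mul_assoc] using this
  -- the step from matrix units to general elements
  have hspan : ∀ a : F, ∃ N : ℝ, 0 ≤ N ∧ ∀ η : ℝ, 0 < η → ∀ V : Submodule ℂ A,
      (∀ i ∈ S, ∀ j ∈ S, ∃ s ∈ V, ‖θ (e i * star (e j)) - s‖ ≤ η) →
      ∃ s ∈ V, ‖θ a - s‖ ≤ N * η := by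
    intro a
    induction h4 a using Submodule.span_induction with
    | mem a ha =>
      obtain ⟨i, hi, j, hj, rfl⟩ := ha
      exact ⟨1, zero_le_one, fun η _ V hV => by simpa using hV i hi j hj⟩
    | zero => exact ⟨0, le_rfl, fun η _ V hV => ⟨0, zero_mem _, by simp⟩⟩
    | add b c _ _ hb hc =>
      obtain ⟨N, hN, hb⟩ := hb
      obtain ⟨M, hM, hc⟩ := hc
      refine ⟨N + M, by positivity, fun η hη V hV => ?_⟩
      obtain ⟨s, hs, hs'⟩ := hb η hη V hV
      obtain ⟨t, ht, ht'⟩ := hc η hη V hV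
      refine ⟨s + t, add_mem hs ht, ?_⟩
      rw [map_add, add_sub_add_comm, add_mul]
      exact norm_add_le_of_le hs' ht'
    | smul r b _ hb =>
      obtain ⟨N, hN, hb⟩ := hb
      refine ⟨‖r‖ * N, by positivity, fun η hη V hV => ?_⟩
      obtain ⟨s, hs, hs'⟩ := hb η hη V hV
      refine ⟨r • s, Submodule.smul_mem _ _ hs, ?_⟩
      rw [map_smul, ← smul_sub, norm_smul, mul_assoc]
      gcongr
  choose N hN hNV using hspan
  set M := ∑ a ∈ Y, N a with hM
  have hM0 : 0 ≤ M := Finset.sum_nonneg fun a _ => hN a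
  have hMY : ∀ a ∈ Y, N a ≤ M := fun a ha => Finset.single_le_sum (fun a _ => hN a) ha
  set η := ε / (3 * (M + 1)) with hη
  have hη0 : 0 < η := by positivity
  -- local data
  have hrr' : ∀ x : A, (∃ z, x = star z * z) ∧ ‖x‖ ≤ 1 →
    ∃ (G : Set A) (m : A), G.Finite ∧ 0 ∈ G ∧ (∀ g ∈ G, ∀ g' ∈ G, g * g' ∈ G) ∧
      (∀ g ∈ G, star g ∈ G) ∧ (∀ g ∈ G, (star m * (x * x) * m) * g = g) ∧
      ∃ c ∈ Submodule.span ℂ G, ‖x * (m * c * star m) * x - x‖ ≤ η :=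
    fun x hx => aux_rr hrr hx.1 hx.2 hη0
  choose! G m hG1 hG2 hG3 hG4 hG5 c hc hcx using hrr'
  let X : F → A := fun i => θ (star (e i) * e i)
  have hX : ∀ i ∈ S, (∃ z, X i = star z * z) ∧ ‖X i‖ ≤ 1 := by
    intro i hi
    refine ⟨aux_cp_pos θ hcp _, (hn _).trans ?_⟩
    have := CStarRing.norm_star_mul_self (x := star (e i) * e i)
    have h5 : star (star (e i) * e i) * (star (e i) * e i) = star (e i) * e i := by
      rw [star_mul, star_star, ← mul_assoc, h2' i hi]
    rw [h5] at this
    nlinarith [norm_nonneg (star (e i) * e i)]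
  have hXX : ∀ i ∈ S, star (θ (e i)) * θ (e i) = X i * X i := by
    intro i hi
    rw [← hst]
    simp only [X]
    rw [hm, ← mul_assoc, h2 i hi]
  have horth : ∀ i ∈ S, ∀ j ∈ S, i ≠ j → star (θ (e i)) * θ (e j) = 0 := by
    intro i hi j hj hij
    rw [← hst, ← h2' i hi, mul_assoc, hm, mul_assoc, h1 i hi j hj hij]
    simp
  let W : Set A := {a | ∃ i ∈ S, ∃ j ∈ S, X i = X j ∧ ∃ g ∈ G (X i),
    a = θ (e i) * (m (X i) * g * star (m (X i))) * star (θ (e j))}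
  have hfin : (insert 0 W).Finite := by
    apply Set.Finite.insert
    have : W ⊆ ⋃ i ∈ S, ⋃ j ∈ S,
        (fun g => θ (e i) * (m (X i) * g * star (m (X i))) * star (θ (e j))) '' G (X i) := by
      rintro a ⟨i, hi, j, hj, -, g, hg, rfl⟩
      simp only [Set.mem_iUnion]
      exact ⟨i, hi, j, hj, g, hg, rfl⟩
    refine Set.Finite.subset ?_ this
    exact S.finite_toSet.biUnion fun i hi => S.finite_toSet.biUnion fun j _ =>
      (hG1 _ (hX i hi)).image _
  have hmulW : ∀ a ∈ insert 0 W, ∀ b ∈ insert 0 W, a * b ∈ insert 0 W := by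
    rintro a (rfl | ⟨i, hi, j, hj, hij, g, hg, rfl⟩) b (rfl | ⟨k, hk, l, hl, hkl, g', hg', rfl⟩)
    · left; simp
    · left; simp
    · left; simp
    · by_cases hjk : j = k
      · subst hjk
        right
        rw [← hij] at hg' hkl
        refine ⟨i, hi, l, hl, hkl, g * g', hG3 _ (hX i hi) _ hg _ hg', ?_⟩
        rw [← hij]
        have hj' := hXX j hj
        rw [← hij] at hj'
        have h6 := hG5 _ (hX i hi) _ hg'
        calc _ = θ (e i) * (m (X i) * g * (star (m (X i)) * (star (θ (e j)) * θ (e j)) * m (X i) * g')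
              * star (m (X i))) * star (θ (e l)) := by noncomm_ring
          _ = _ := by rw [hj', h6]; noncomm_ring
      · left
        calc _ = θ (e i) * (m (X i) * g * star (m (X i))) * (star (θ (e j)) * θ (e k)) *
              ((m (X k) * g' * star (m (X k))) * star (θ (e l))) := by noncomm_ring
          _ = 0 := by rw [horth j hj k hk hjk]; simp
  have hstarW : ∀ a ∈ insert 0 W, star a ∈ insert 0 W := by
    rintro a (rfl | ⟨i, hi, j, hj, hij, g, hg, rfl⟩)
    · left; simp
    · right
      refine ⟨j, hj, i, hi, hij.symm, star g, ?_, ?_⟩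
      · rw [← hij]; exact hG4 _ (hX i hi) _ hg
      · rw [← hij]; simp only [star_mul, star_star, mul_assoc]
  obtain ⟨C, hC, hCW⟩ := aux_subalg (insert 0 W) hfin hmulW hstarW
  refine ⟨C, hC, fun a ha => ?_⟩
  have hunits : ∀ i ∈ S, ∀ j ∈ S,
      ∃ s ∈ Submodule.span ℂ (insert 0 W), ‖θ (e i * star (e j)) - s‖ ≤ 3 * η := by
    intro i hi j hj
    rcases h3 i hi j hj with hf | hf
    · have hXij : X i = X j := by simp only [X]; rw [hf]
      refine ⟨θ (e i) * (m (X i) * c (X i) * star (m (X i))) * star (θ (e j)), ?_, ?_⟩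
      · have := hc _ (hX i hi)
        generalize c (X i) = c0 at this
        induction this using Submodule.span_induction with
        | mem g hg => exact Submodule.subset_span (Or.inr ⟨i, hi, j, hj, hXij, g, hg, rfl⟩)
        | zero => simp
        | add b c _ _ hb hc =>
          simp only [mul_add, add_mul]; exact add_mem hb hc
        | smul r b _ hb =>
          simp only [mul_smul_comm, smul_mul_assoc]; exact Submodule.smul_mem _ _ hb
      · apply aux_approx (hX i hi).1 (g := θ (e i * star (e i))) _ (hXX i hi) _ _ _ _ hη0
          (hcx _ (hX i hi))
        · have := aux_cp_pos θ hcp (star (e i)); rwa [star_star] at this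
        · rw [star_star, hXij]; exact hXX j hj
        · exact (hm _ _ _).symm
        · rw [← hst, ← hm, h2 i hi]
        · rw [← hst, star_mul, star_star, ← hm, mul_assoc (e i), ← hf, ← mul_assoc, h2 i hi]
          rw [← hm (e i * star (e i)) (e i), h2 i hi]
    · exact ⟨0, zero_mem _, by rw [hf]; simp; positivity⟩
  obtain ⟨s, hs, hs'⟩ := hNV a (3 * η) (by positivity) (Submodule.span ℂ (insert 0 W)) hunits
  · refine ⟨s, (hCW s).2 hs, hs'.trans_lt ?_⟩
    calc N a * (3 * η) ≤ M * (3 * η) := by gcongr; exact hMY a ha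
      _ < (M + 1) * (3 * η) := by gcongr; linarith
      _ = ε := by rw [hη]; field_simp

theorem aux_cp_hom {A : Type u} {B : Type v} [NonUnitalCStarAlgebra A] [NonUnitalCStarAlgebra B]
    (f : A →ₗ[ℂ] B) (hm : ∀ a b, f (a * b) = f a * f b) (hs : ∀ a, f (star a) = star (f a)) :
    IsCP f := by
  rintro k x ⟨y, rfl⟩
  refine ⟨y.map f, ?_⟩
  ext i j
  simp [Matrix.mul_apply, Matrix.star_apply, hm, hs, map_sum]

theorem aux_cp_comp {A : Type u} {B : Type v} {C : Type*} [NonUnitalCStarAlgebra A]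
    [NonUnitalCStarAlgebra B] [NonUnitalCStarAlgebra C]
    (f : A →ₗ[ℂ] B) (g : B →ₗ[ℂ] C) (hf : IsCP f) (hg : IsCP g) : IsCP (g ∘ₗ f) := by
  intro k x hx
  have := hg k _ (hf k x hx)
  rwa [Matrix.map_map] at this

theorem aux_cp_single {n : ℕ} (F : Fin n → Type v) [∀ i, NonUnitalCStarAlgebra (F i)] (i : Fin n) :
    IsCP (LinearMap.single ℂ F i) := by
  apply aux_cp_hom
  · intro a b
    simp only [LinearMap.single_apply]
    exact Pi.single_mul i a b
  · intro a
    simp only [LinearMap.single_apply]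
    exact Pi.single_star i a

theorem aux_cp_proj {n : ℕ} (F : Fin n → Type v) [∀ i, NonUnitalCStarAlgebra (F i)] (i : Fin n) :
    IsCP (LinearMap.proj i : (∀ i, F i) →ₗ[ℂ] F i) := by
  apply aux_cp_hom
  · intro a b; simp
  · intro a; simp

theorem aux_cp_star {A : Type u} {B : Type v} [CStarAlgebra A] [NonUnitalCStarAlgebra B]
    (f : A →ₗ[ℂ] B) (hf : IsCP f) (a : A) : f (star a) = star (f a) := by
  obtain ⟨z1, z2, w1, w2, h1, h2, h3, h4⟩ := aux_cp_two f hf a 1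
  rw [star_one, one_mul] at h2
  rw [mul_one] at h3
  rw [h2, h3]; simp

theorem aux_pos_summand {A : Type u} [CStarAlgebra A] {a b : A} {r : ℝ}
    (h : ‖star a * a + star b * b‖ ≤ r) : ‖star a * a‖ ≤ r ∧ ‖star b * b‖ ≤ r := by
  let _ := CStarAlgebra.spectralOrder A
  have := CStarAlgebra.spectralOrderedRing A
  have ha := star_mul_self_nonneg a
  have hb := star_mul_self_nonneg b
  exact ⟨(CStarAlgebra.norm_le_norm_of_nonneg_of_le ha (le_add_of_nonneg_right hb)).trans h,
    (CStarAlgebra.norm_le_norm_of_nonneg_of_le hb (le_add_of_nonneg_left ha)).trans h⟩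

theorem aux_pos_summand4 {A : Type u} [CStarAlgebra A] {a b c d : A} {r : ℝ} (hr : 0 ≤ r)
    (h : ‖star a * a + star b * b + (star c * c + star d * d)‖ ≤ r ^ 2) :
    ‖a‖ ≤ r ∧ ‖b‖ ≤ r ∧ ‖c‖ ≤ r ∧ ‖d‖ ≤ r := by
  let _ := CStarAlgebra.spectralOrder A
  have := CStarAlgebra.spectralOrderedRing A
  have ha := star_mul_self_nonneg a
  have hb := star_mul_self_nonneg b
  have hc := star_mul_self_nonneg c
  have hd := star_mul_self_nonneg d
  have key : ∀ t : A, star t * t ≤ star a * a + star b * b + (star c * c + star d * d) →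
      ‖t‖ ≤ r := by
    intro t ht
    have h1 := (CStarAlgebra.norm_le_norm_of_nonneg_of_le (star_mul_self_nonneg t) ht).trans h
    rw [CStarRing.norm_star_mul_self, ← pow_two] at h1
    exact le_of_sq_le_sq h1 hr
  refine ⟨key a ?_, key b ?_, key c ?_, key d ?_⟩
  · exact (le_add_of_nonneg_right hb).trans (le_add_of_nonneg_right (add_nonneg hc hd))
  · exact (le_add_of_nonneg_left ha).trans (le_add_of_nonneg_right (add_nonneg hc hd))
  · exact (le_add_of_nonneg_right hd).trans (le_add_of_nonneg_left (add_nonneg ha hb))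
  · exact (le_add_of_nonneg_left hc).trans (le_add_of_nonneg_left (add_nonneg ha hb))

/-- The multiplicative domain estimate for a pair of completely positive maps whose sum is
approximately the identity. -/
theorem aux_mult {A : Type u} [CStarAlgebra A] (f g : A →ₗ[ℂ] A) (hf : IsCP f) (hg : IsCP g)
    (hf1 : ‖f 1‖ ≤ 1) {δ : ℝ} (hδ : 0 ≤ δ) (x : A)
    (h1 : ‖f 1 + g 1 - 1‖ ≤ δ ^ 2) (hx : ‖f x + g x - x‖ ≤ δ ^ 2)
    (hxs : ‖f (star x) + g (star x) - star x‖ ≤ δ ^ 2)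
    (hxx : ‖f (star x * x) + g (star x * x) - star x * x‖ ≤ δ ^ 2) :
    ‖f x - f 1 * x‖ ≤ 2 * (δ * (1 + ‖x‖)) := by
  obtain ⟨z1, z2, w1, w2, a1, a2, a3, a4⟩ := aux_cp_two f hf x 1
  obtain ⟨y1, y2, v1, v2, b1, b2, b3, b4⟩ := aux_cp_two g hg x 1
  simp only [star_one, one_mul, mul_one] at a2 a3 a4 b2 b3 b4
  have e : star (z1 - w1 * x) * (z1 - w1 * x) + star (z2 - w2 * x) * (z2 - w2 * x) +
      (star (y1 - v1 * x) * (y1 - v1 * x) + star (y2 - v2 * x) * (y2 - v2 * x)) =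
      (f (star x * x) + g (star x * x) - star x * x) - (f (star x) + g (star x) - star x) * x
      - star x * (f x + g x - x) + star x * (f 1 + g 1 - 1) * x := by
    rw [a1, a2, a3, a4, b1, b2, b3, b4]
    simp only [star_sub, star_mul]
    noncomm_ring
  have hn : ‖star x‖ = ‖x‖ := norm_star x
  obtain ⟨n1, n2, -, -⟩ := aux_pos_summand4 (r := δ * (1 + ‖x‖)) (by positivity) (by
    rw [e]
    have m1 : ‖(f (star x) + g (star x) - star x) * x‖ ≤ δ ^ 2 * ‖x‖ :=
      norm_mul_le_of_le hxs le_rfl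
    have m2 : ‖star x * (f x + g x - x)‖ ≤ ‖x‖ * δ ^ 2 := norm_mul_le_of_le hn.le hx
    have m3 : ‖star x * (f 1 + g 1 - 1) * x‖ ≤ ‖x‖ * δ ^ 2 * ‖x‖ :=
      norm_mul_le_of_le (norm_mul_le_of_le hn.le h1) le_rfl
    refine (norm_add_le_of_le (norm_sub_le_of_le (norm_sub_le_of_le hxx m1) m2) m3).trans
      (le_of_eq ?_)
    ring)
  have hw : ‖w1‖ ≤ 1 ∧ ‖w2‖ ≤ 1 := by
    have := aux_pos_summand4 (a := w1) (b := w2) (c := 0) (d := 0) (r := 1) zero_le_one (by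
      rw [← a4]; simpa using hf1)
    exact ⟨this.1, this.2.1⟩
  have e2 : f x - f 1 * x = star w1 * (z1 - w1 * x) + star w2 * (z2 - w2 * x) := by
    rw [a2, a4]; noncomm_ring
  rw [e2]
  have m1 : ‖star w1 * (z1 - w1 * x)‖ ≤ 1 * (δ * (1 + ‖x‖)) :=
    norm_mul_le_of_le (by rw [norm_star]; exact hw.1) n1
  have m2 : ‖star w2 * (z2 - w2 * x)‖ ≤ 1 * (δ * (1 + ‖x‖)) :=
    norm_mul_le_of_le (by rw [norm_star]; exact hw.2) n2
  refine (norm_add_le_of_le m1 m2).trans (le_of_eq ?_)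
  ring

/-- Theorem 3.7 of the paper.  If `A` is a separable, unital C*-algebra
with real rank zero and nuclear dimension at most one, then `A` has weak complexity rank at
most one. -/
theorem weakCRLeOne_of_rr0_nucdim_one
    (A : Type u) [CStarAlgebra A] [TopologicalSpace.SeparableSpace A]
    (hrr : RealRankZero A) (hnd : NuclearDimLE 1 A) :
    WeakCRLeOne A := by
  classical
  intro X ε hε
  set M := ∑ x ∈ X, ‖x‖ with hM
  have hM0 : 0 ≤ M := Finset.sum_nonneg fun x _ => norm_nonneg x
  have hMX : ∀ x ∈ X, ‖x‖ ≤ M := fun x hx => Finset.single_le_sum (fun x _ => norm_nonneg x) hx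
  set δ := min 1 (ε / (8 * (1 + M))) with hδ
  have hδ0 : 0 < δ := by positivity
  have hδ1 : δ ≤ 1 := min_le_left _ _
  have hδε : δ * (1 + M) ≤ ε / 8 := by
    have : δ ≤ ε / (8 * (1 + M)) := min_le_right _ _
    calc δ * (1 + M) ≤ ε / (8 * (1 + M)) * (1 + M) := by gcongr
      _ = ε / 8 := by field_simp
  have hδM : δ ≤ δ * (1 + M) := by nlinarith
  have hδ2 : δ ^ 2 ≤ δ := by nlinarith
  obtain ⟨F, instF, hfd, ψ, φ, hψ, hψn, hφ, hφi, happ⟩ :=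
    hnd (insert 1 (X ∪ X.image star ∪ X.image (fun x => star x * x) ∪ X.image (fun x => x * star x)))
      (δ ^ 2) (by positivity)
  let θ : ∀ i, F i →ₗ[ℂ] A := fun i => φ ∘ₗ LinearMap.single ℂ F i
  have hθ : ∀ i, IsCP (θ i) := fun i => aux_cp_comp _ _ (aux_cp_single F i) hφ
  let f : Fin 2 → A →ₗ[ℂ] A := fun i => θ i ∘ₗ (LinearMap.proj i ∘ₗ ψ)
  have hf : ∀ i, IsCP (f i) := fun i =>
    aux_cp_comp _ _ (aux_cp_comp _ _ hψ (aux_cp_proj F i)) (hθ i)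
  have hfθ : ∀ i a, f i a = θ i (ψ a i) := fun i a => rfl
  have hsum : ∀ a, f 0 a + f 1 a = φ (ψ a) := by
    intro a
    simp only [f, θ, LinearMap.comp_apply, LinearMap.proj_apply]
    rw [← map_add]
    congr 1
    ext i
    fin_cases i <;> simp
  have hone : ‖(1 : A)‖ ≤ 1 := by
    have := CStarRing.norm_star_mul_self (x := (1 : A))
    rw [star_one, one_mul] at this
    nlinarith [norm_nonneg (1 : A)]
  have hf1 : ∀ i, ‖f i 1‖ ≤ 1 := fun i =>
    ((hφi i).1 _).trans ((norm_le_pi_norm (ψ 1) i).trans ((hψn 1).trans hone))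
  have a1 : ‖f 0 1 + f 1 1 - 1‖ ≤ δ ^ 2 := by rw [hsum]; exact (happ _ (by simp)).le
  have a2 : ∀ x ∈ X, ‖f 0 x + f 1 x - x‖ ≤ δ ^ 2 := by
    intro x hx; rw [hsum]; exact (happ _ (by simp [hx])).le
  have a3 : ∀ x ∈ X, ‖f 0 (star x) + f 1 (star x) - star x‖ ≤ δ ^ 2 := by
    intro x hx; rw [hsum]
    exact (happ _ (by simp only [Finset.mem_insert, Finset.mem_union, Finset.mem_image]; exact Or.inr (Or.inl (Or.inl (Or.inr ⟨x, hx, rfl⟩))))).le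
  have a4 : ∀ x ∈ X, ‖f 0 (star x * x) + f 1 (star x * x) - star x * x‖ ≤ δ ^ 2 := by
    intro x hx; rw [hsum]
    exact (happ _ (by simp only [Finset.mem_insert, Finset.mem_union, Finset.mem_image]; exact Or.inr (Or.inl (Or.inr ⟨x, hx, rfl⟩)))).le
  have a5 : ∀ x ∈ X, ‖f 0 (x * star x) + f 1 (x * star x) - x * star x‖ ≤ δ ^ 2 := by
    intro x hx; rw [hsum]
    exact (happ _ (by simp only [Finset.mem_insert, Finset.mem_union, Finset.mem_image]; exact Or.inr (Or.inr ⟨x, hx, rfl⟩))).le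
  have b1 : ∀ x ∈ X, ‖f 0 x - f 0 1 * x‖ ≤ ε / 4 := by
    intro x hx
    refine (aux_mult (f 0) (f 1) (hf 0) (hf 1) (hf1 0) hδ0.le x a1 (a2 x hx) (a3 x hx) (a4 x hx)).trans ?_
    have : δ * (1 + ‖x‖) ≤ δ * (1 + M) := by gcongr; exact hMX x hx
    linarith
  have b2 : ∀ x ∈ X, ‖f 0 x - x * f 0 1‖ ≤ ε / 4 := by
    intro x hx
    have h := aux_mult (f 0) (f 1) (hf 0) (hf 1) (hf1 0) hδ0.le (star x) a1 (a3 x hx)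
      (by rw [star_star]; exact a2 x hx) (by rw [star_star]; exact a5 x hx)
    rw [norm_star, ← norm_star (f 0 (star x) - f 0 1 * star x), star_sub, star_mul, star_star, ← aux_cp_star _ (hf 0), ← aux_cp_star _ (hf 0), star_star, star_one] at h
    refine h.trans ?_
    have : δ * (1 + ‖x‖) ≤ δ * (1 + M) := by gcongr; exact hMX x hx
    linarith
  have hC : ∀ i, ∃ C : NonUnitalStarSubalgebra ℂ A, FiniteDimensional ℂ C ∧
      ∀ a ∈ X.image (fun x => ψ x i), MemEps (ε / 4) (C : Set A) (θ i a) := by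
    intro i
    have := hfd i
    exact aux_oz_image hrr (θ i) (hθ i) (hφi i).1 (hφi i).2 _ (by positivity)
  obtain ⟨C, hCf, hC0⟩ := hC 0
  obtain ⟨D, hDf, hD1⟩ := hC 1
  refine ⟨C, D, hCf, hDf, f 0 1, ?_, hf1 0, ?_, ?_, ?_⟩
  · have := aux_cp_pos (f 0) (hf 0) 1
    rwa [star_one, one_mul] at this
  · intro x hx
    have e : f 0 1 * x - x * f 0 1 = (f 0 x - x * f 0 1) - (f 0 x - f 0 1 * x) := by abel
    rw [e]
    refine (norm_sub_le_of_le (b2 x hx) (b1 x hx)).trans_lt (by linarith)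
  · intro x hx
    obtain ⟨s, hs, hs'⟩ := hC0 (ψ x 0) (Finset.mem_image_of_mem _ hx)
    refine ⟨s, hs, ?_⟩
    rw [← hfθ] at hs'
    have e : f 0 1 * x - s = (f 0 x - s) - (f 0 x - f 0 1 * x) := by abel
    rw [e]
    refine (norm_sub_le_of_le hs'.le (b1 x hx)).trans_lt (by linarith)
  · intro x hx
    obtain ⟨s, hs, hs'⟩ := hD1 (ψ x 1) (Finset.mem_image_of_mem _ hx)
    refine ⟨s, hs, ?_⟩
    rw [← hfθ] at hs'
    have e : (1 - f 0 1) * x - s = (f 1 x - s) + (f 0 x - f 0 1 * x) - (f 0 x + f 1 x - x) := by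
      rw [sub_mul, one_mul]; abel
    rw [e]
    refine (norm_sub_le_of_le (norm_add_le_of_le hs'.le (b1 x hx)) (a2 x hx)).trans_lt ?_
    linarith
end

section
/- Let A be a unital C*-algebra with weak complexity rank at most one. Then for any n ≥ 1, any positive element a ∈ M_n(A), and any ε > 0, there exist m ≥ 1 and a projection p ∈ M_m(A) such that (a − ε)₊ ≲ p and p ≲ a ⊕ a. -/
universe u

open Matrix

/-- Cuntz subequivalence `a ≲ b` for positive matrices over a C*-algebra: there are
rectangular matrices `r` with `r * b * rᴴ → a`.  (Since all C*-norms on a matrix algebra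
over a C*-algebra induce the topology of entrywise convergence, we express the convergence
entrywise.) -/
def CuntzLE {A : Type u} [CStarAlgebra A] {ι κ : Type} [Fintype ι] [Fintype κ]
    (a : Matrix ι ι A) (b : Matrix κ κ A) : Prop :=
  ∀ δ : ℝ, 0 < δ → ∃ r : Matrix ι κ A, ∀ i j, ‖(r * b * rᴴ - a) i j‖ < δ

/-- `c` is the cut-down `(a - ε)₊` of the positive matrix `a`, characterized by uniform
polynomial approximation of the function `t ↦ max (t - ε) 0` on an interval containing the
spectrum of `a` (again with entrywise convergence in the matrix algebra). -/
def IsCutoffApprox {A : Type u} [CStarAlgebra A] {n : ℕ} (ε : ℝ)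
    (a c : Matrix (Fin n) (Fin n) A) : Prop :=
  ∀ δ : ℝ, 0 < δ → ∃ p : Polynomial ℂ,
    (∀ t : ℝ, t ∈ Set.Icc (0 : ℝ) (∑ i, ∑ j, ‖a i j‖) →
      ‖(Polynomial.eval (t : ℂ) p) - ((max (t - ε) 0 : ℝ) : ℂ)‖ < δ) ∧
    (∀ i j, ‖((Polynomial.aeval a) p - c) i j‖ < δ)


theorem aux_fin_spec {B : Type*} [CStarAlgebra B] (c : B) (P : Polynomial ℂ) (hP : P ≠ 0) (h : Polynomial.aeval c P = 0) :
    (spectrum ℝ c).Finite := by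
  nontriviality B
  have h1 : spectrum ℂ c ⊆ {z | P.IsRoot z} := by
    intro z hz
    have := spectrum.subset_polynomial_aeval c P ⟨z, hz, rfl⟩
    rw [h, spectrum.zero_eq] at this
    simpa using this
  have h2 : (spectrum ℂ c).Finite := (Polynomial.finite_setOfPred_isRoot hP).subset h1
  refine (h2.preimage (Complex.ofReal_injective.injOn)).subset ?_
  intro t ht
  exact spectrum.algebraMap_mem ℂ ht

section abstract_part
variable {B : Type*} [CStarAlgebra B] [PartialOrder B] [StarOrderedRing B]

theorem aux_cuntz_of_le (y z : B) (hy : 0 ≤ y) (hyz : y ≤ z) (δ : ℝ) (hδ : 0 < δ) :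
    ∃ r : B, ‖r * z * star r - y‖ ≤ δ := by
  have hz : 0 ≤ z := hy.trans hyz
  have hpos : IsStrictlyPositive (algebraMap ℝ B δ) :=
    isStrictlyPositive_algebraMap hδ
  have hw : IsStrictlyPositive (z + algebraMap ℝ B δ) := IsStrictlyPositive.nonneg_add hz hpos
  set w := z + algebraMap ℝ B δ with hwdef
  set v : B := w ^ (-(1 / 2) : ℝ) with hv
  have hvw : v * w * v = 1 := CFC.conjugate_rpow_neg_one_half w
  have hvs : star v = v := (IsSelfAdjoint.of_nonneg (CFC.rpow_nonneg)).star_eq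
  set s := CFC.sqrt y with hs
  have hss : s * s = y := CFC.sqrt_mul_sqrt_self y
  have hssa : star s = s := (IsSelfAdjoint.of_nonneg (CFC.sqrt_nonneg y)).star_eq
  have hn : ‖s * v‖ ≤ 1 := by
    refine (le_iff_norm_sqrt_mul_rpow y w hy hw).1 (hyz.trans ?_)
    exact le_add_of_nonneg_right hpos.nonneg
  refine ⟨s * v, ?_⟩
  have e : s * v * z * star (s * v) - y = - (δ • (s * v * star (s * v))) := by
    have hz' : z = w - algebraMap ℝ B δ := by simp [hwdef]
    rw [star_mul, hvs, hssa, hz', Algebra.algebraMap_eq_smul_one]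
    have : s * v * (w - δ • 1) * (v * s) = s * (v * w * v) * s - δ • (s * v * (v * s)) := by
      simp only [mul_sub, sub_mul, mul_assoc, mul_smul_comm, smul_mul_assoc, one_mul]
    rw [this, hvw, mul_one, hss]; abel
  rw [e, norm_neg, norm_smul, CStarRing.norm_self_mul_star, Real.norm_eq_abs, abs_of_pos hδ]
  have : ‖s * v‖ * ‖s * v‖ ≤ 1 := mul_le_one₀ hn (norm_nonneg _) hn
  nlinarith

theorem aux_cuntz_of_le_conj (y z g : B) (t : ℝ) (ht : 0 ≤ t) (hg : star g = g) (hy : 0 ≤ y)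
    (hyz : y ≤ t • (g * z * g)) (δ : ℝ) (hδ : 0 < δ) :
    ∃ s : B, ‖s * z * star s - y‖ ≤ δ := by
  obtain ⟨r, hr⟩ := aux_cuntz_of_le y _ hy hyz δ hδ
  refine ⟨Real.sqrt t • (r * g), ?_⟩
  convert hr using 3
  rw [star_smul, star_mul, hg]
  simp only [smul_mul_assoc, mul_smul_comm, smul_smul, star_trivial, Real.mul_self_sqrt ht,
    mul_assoc]

theorem aux_proj_s18 (c : B) (hc : IsSelfAdjoint c) (hf : (spectrum ℝ c).Finite) (θ : ℝ) (hθ : 0 < θ) :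
    ∃ p : B, star p = p ∧ p * p = p ∧ θ • p ≤ p * c * p ∧ c ≤ ‖c‖ • p + θ • (1 : B) := by
  classical
  set χ : ℝ → ℝ := fun t => if θ ≤ t then 1 else 0 with hχ
  have hcont : ∀ f : ℝ → ℝ, ContinuousOn f (spectrum ℝ c) := fun f => hf.continuousOn f
  set p := cfc χ c with hp
  have hcid : cfc (fun t : ℝ => t) c = c := cfc_id' ℝ c
  refine ⟨p, ?_, ?_, ?_, ?_⟩
  · exact (cfc_predicate χ c : IsSelfAdjoint (cfc χ c)).star_eq
  · rw [hp, ← cfc_mul χ χ c (hcont _) (hcont _)]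
    congr 1; ext t; simp [hχ]
  · have e1 : p * c * p = cfc (fun t => χ t * t * χ t) c := by
      rw [cfc_mul (fun t => χ t * t) χ c (hcont _) (hcont _),
        cfc_mul χ (fun t => t) c (hcont _) (hcont _), hcid]
    have e2 : θ • p = cfc (fun t => θ * χ t) c := by
      rw [cfc_const_mul θ χ c (hcont _)]
    rw [e1, e2]
    refine cfc_mono (fun t ht => ?_) (hcont _) (hcont _)
    by_cases h : θ ≤ t <;> simp [hχ, h]
  · have e2 : ‖c‖ • p + θ • (1 : B) = cfc (fun t => ‖c‖ * χ t + θ) c := by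
      rw [cfc_add_const θ (fun t => ‖c‖ * χ t) c (hcont _), cfc_const_mul _ χ c (hcont _),
        Algebra.algebraMap_eq_smul_one]
    rw [e2]
    nth_rewrite 1 [← hcid]
    refine cfc_mono (fun t ht => ?_) (hcont _) (hcont _)
    have hB : Nontrivial B := by
      by_contra hB
      rw [not_nontrivial_iff_subsingleton] at hB
      simp at ht
    have h1 : ‖t‖ ≤ ‖c‖ := spectrum.norm_le_norm_of_mem ht
    have h2 : t ≤ ‖c‖ := (le_abs_self t).trans h1
    by_cases h : θ ≤ t
    · simp [hχ, h]; linarith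
    · simp [hχ, h]; linarith

theorem aux_half (b H c : B) (hb : star b = b) (hH1 : H ≤ 1) (hH0 : 0 ≤ H)
    (hc : IsSelfAdjoint c) (hf : (spectrum ℝ c).Finite) (η : ℝ) (hη : 0 < η)
    (hcb : ‖c - b * H * b‖ ≤ η) :
    ∃ p : B, star p = p ∧ p * p = p ∧ η • p ≤ p * (b * b) * p ∧
      b * H * b ≤ ‖c‖ • p + (3 * η) • (1 : B) := by
  obtain ⟨p, hp1, hp2, hp3, hp4⟩ := aux_proj_s18 c hc hf (2 * η) (by positivity)
  have hHs : IsSelfAdjoint (b * H * b) := by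
    have := (IsSelfAdjoint.of_nonneg hH0).conjugate b
    rwa [hb] at this
  have hsa : IsSelfAdjoint (c - b * H * b) := hc.sub hHs
  have hη1 : algebraMap ℝ B ‖c - b * H * b‖ ≤ η • (1 : B) := by
    rw [Algebra.algebraMap_eq_smul_one]
    exact smul_le_smul_of_nonneg_right hcb zero_le_one
  have u1 : c - b * H * b ≤ η • (1 : B) := hsa.le_algebraMap_norm_self.trans hη1
  have u2 : -(η • (1 : B)) ≤ c - b * H * b :=
    (neg_le_neg hη1).trans hsa.neg_algebraMap_norm_le_self
  refine ⟨p, hp1, hp2, ?_, ?_⟩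
  · have k1 : c - η • (1 : B) ≤ b * b := by
      have k : b * H * b ≤ b * b := by
        have := star_left_conjugate_le_conjugate hH1 b
        simpa [hb] using this
      exact (sub_le_comm.1 u1).trans k
    have k2 := star_left_conjugate_le_conjugate k1 p
    rw [hp1] at k2
    refine le_trans ?_ k2
    have : p * (c - η • (1 : B)) * p = p * c * p - η • p := by
      simp [mul_sub, sub_mul, hp2]
    rw [this, le_sub_iff_add_le, ← add_smul]
    convert hp3 using 2; ring
  · have : b * H * b ≤ c + η • (1 : B) := by
      rw [neg_le_sub_iff_le_add] at u2
      exact u2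
    refine this.trans ((add_le_add_left hp4 _).trans (le_of_eq ?_))
    rw [add_assoc, ← add_smul]; congr 2; ring

theorem aux_cut (a k : B) (ha : 0 ≤ a) (ε ε' : ℝ) (h : ε' < ε)
    (hk : a ≤ k + ε' • (1 : B)) :
    ∃ g : B, star g = g ∧ cfc (fun t : ℝ => max (t - ε) 0) a ≤ g * k * g := by
  have hsa : IsSelfAdjoint a := .of_nonneg ha
  have hpos : 0 < ε - ε' := by linarith
  set f : ℝ → ℝ := fun t => Real.sqrt (max (t - ε) 0) * Real.sqrt (ε - ε')⁻¹ with hf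
  have hfc : Continuous f := by fun_prop
  have hff : ∀ t, f t * f t = max (t - ε) 0 * (ε - ε')⁻¹ := by
    intro t
    have h1 := Real.mul_self_sqrt (le_max_right (t - ε) 0)
    have h2 := Real.mul_self_sqrt (inv_nonneg.2 hpos.le)
    simp only [hf]
    rw [mul_mul_mul_comm, h1, h2]
  set g := cfc f a with hg
  have hgs : star g = g := (cfc_predicate f a : IsSelfAdjoint (cfc f a)).star_eq
  refine ⟨g, hgs, ?_⟩
  have k1 := star_left_conjugate_le_conjugate (sub_le_iff_le_add.2 hk) g
  rw [hgs] at k1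
  refine le_trans ?_ k1
  have e : g * (a - ε' • (1 : B)) * g = cfc (fun t => f t * (t - ε') * f t) a := by
    have e0 : a - ε' • (1 : B) = cfc (fun t => t - ε') a := by
      rw [cfc_sub (fun t => t) (fun _ => ε') a, cfc_id' ℝ a, cfc_const ε' a, Algebra.algebraMap_eq_smul_one]
    rw [cfc_mul (fun t => f t * (t - ε')) f a, cfc_mul f (fun t => t - ε') a, e0]
  rw [e]
  refine cfc_mono (fun t ht => ?_) (by fun_prop) (by fun_prop)
  have : f t * (t - ε') * f t = max (t - ε) 0 * ((ε - ε')⁻¹ * (t - ε')) := by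
    rw [mul_right_comm, hff]; ring
  rw [this]
  rcases le_total (t - ε) 0 with h0 | h0
  · simp [max_eq_right h0]
  · rw [max_eq_left h0]
    refine le_mul_of_one_le_right h0 ?_
    rw [inv_mul_eq_div, one_le_div hpos]; linarith

theorem aux_poly (a : B) (ha : 0 ≤ a) (ε M : ℝ) (hM : ‖a‖ ≤ M) (δ : ℝ) (hδ : 0 < δ) :
    ∃ P : Polynomial ℂ,
    (∀ t : ℝ, t ∈ Set.Icc (0 : ℝ) M →
      ‖(Polynomial.eval (t : ℂ) P) - ((max (t - ε) 0 : ℝ) : ℂ)‖ < δ) ∧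
    ‖Polynomial.aeval a P - cfc (fun t : ℝ => max (t - ε) 0) a‖ < δ := by
  have hsa : IsSelfAdjoint a := .of_nonneg ha
  obtain ⟨P, hP⟩ := exists_polynomial_near_of_continuousOn 0 M
    (fun t => max (t - ε) 0) (by fun_prop) (δ / 2) (by positivity)
  refine ⟨P.map (algebraMap ℝ ℂ), fun t ht => ?_, ?_⟩
  · have h1 : Polynomial.eval (t : ℂ) (P.map (algebraMap ℝ ℂ)) = ((P.eval t : ℝ) : ℂ) := by
      have := Polynomial.eval_map_algebraMap P (t : ℂ)
      rw [this]
      exact Polynomial.aeval_algebraMap_apply ℂ t P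
    rw [h1, ← Complex.ofReal_sub, Complex.norm_real]
    exact (hP t ht).trans (by linarith)
  · rw [Polynomial.aeval_map_algebraMap, ← cfc_polynomial P a hsa,
      ← cfc_sub (fun t => P.eval t) (fun t : ℝ => max (t - ε) 0) a]
    refine lt_of_le_of_lt (norm_cfc_le (c := δ / 2) (by positivity) fun t ht => ?_)
      (by linarith)
    have hB : Nontrivial (B) := by
      by_contra hB
      rw [not_nontrivial_iff_subsingleton] at hB
      simp at ht
    have h1 : ‖t‖ ≤ ‖a‖ := spectrum.norm_le_norm_of_mem ht
    have h2 : t ≤ ‖a‖ := (le_abs_self t).trans h1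
    exact (hP t ⟨spectrum_nonneg_of_nonneg ha ht, h2.trans hM⟩).le

theorem aux_sqrt (a : B) (ha : 0 ≤ a) : ∃ b : B, star b = b ∧ b * b = a :=
  ⟨CFC.sqrt a, (IsSelfAdjoint.of_nonneg (CFC.sqrt_nonneg a)).star_eq,
    CFC.sqrt_mul_sqrt_self a⟩

theorem aux_core (a b H c d : B) (ha : 0 ≤ a) (hbs : star b = b) (hbb : b * b = a)
    (hH0 : 0 ≤ H) (hH1 : 0 ≤ 1 - H) (ε : ℝ) (hε : 0 < ε)
    (hc1 : IsSelfAdjoint c) (hc2 : ∃ P : Polynomial ℂ, P ≠ 0 ∧ Polynomial.aeval c P = 0)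
    (hc3 : ‖c - b * H * b‖ ≤ ε / 7)
    (hd1 : IsSelfAdjoint d) (hd2 : ∃ P : Polynomial ℂ, P ≠ 0 ∧ Polynomial.aeval d P = 0)
    (hd3 : ‖d - b * (1 - H) * b‖ ≤ ε / 7) :
    ∃ p q k : B, star p = p ∧ p * p = p ∧ star q = q ∧ q * q = q ∧
      (∀ δ : ℝ, 0 < δ → ∃ s : B, ‖s * a * star s - p‖ ≤ δ) ∧
      (∀ δ : ℝ, 0 < δ → ∃ s : B, ‖s * a * star s - q‖ ≤ δ) ∧
      (∀ δ : ℝ, 0 < δ → ∃ s : B, ‖s * (p + q) * star s - k‖ ≤ δ) ∧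
      (∀ M : ℝ, ‖a‖ ≤ M → ∀ δ : ℝ, 0 < δ → ∃ P : Polynomial ℂ,
        (∀ t : ℝ, t ∈ Set.Icc (0 : ℝ) M →
          ‖(Polynomial.eval (t : ℂ) P) - ((max (t - ε) 0 : ℝ) : ℂ)‖ < δ) ∧
        ‖Polynomial.aeval a P - k‖ < δ) := by
  obtain ⟨Pc, hPc, hPc'⟩ := hc2
  obtain ⟨Pd, hPd, hPd'⟩ := hd2
  set η := ε / 7 with hη
  have hη0 : 0 < η := by positivity
  obtain ⟨p, hp1, hp2, hp3, hp4⟩ := aux_half b H c hbs (sub_nonneg.1 hH1) hH0 hc1 (aux_fin_spec c Pc hPc hPc') η hη0 hc3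
  obtain ⟨q, hq1, hq2, hq3, hq4⟩ := aux_half b (1 - H) d hbs (sub_le_self _ hH0) hH1 hd1
    (aux_fin_spec d Pd hPd hPd') η
    hη0 hd3
  have hp0 : 0 ≤ p := by
    have := star_mul_self_nonneg p
    rwa [hp1, hp2] at this
  have hq0 : 0 ≤ q := by
    have := star_mul_self_nonneg q
    rwa [hq1, hq2] at this
  rw [hbb] at hp3 hq3
  have key : ∀ p : B, 0 ≤ p → star p = p → η • p ≤ p * a * p →
      ∀ δ : ℝ, 0 < δ → ∃ s : B, ‖s * a * star s - p‖ ≤ δ := by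
    intro p hp0 hp1 hp3
    refine aux_cuntz_of_le_conj p a p η⁻¹ (by positivity) hp1 hp0 ?_
    have := smul_le_smul_of_nonneg_left hp3 (inv_nonneg.2 hη0.le)
    rwa [smul_smul, inv_mul_cancel₀ hη0.ne', one_smul] at this
  refine ⟨p, q, cfc (fun t : ℝ => max (t - ε) 0) a, hp1, hp2, hq1, hq2, key p hp0 hp1 hp3, key q hq0 hq1 hq3, ?_,
    fun M hM δ hδ => aux_poly a ha ε M hM δ hδ⟩
  set K := max ‖c‖ ‖d‖ with hK
  have hK0 : 0 ≤ K := (norm_nonneg c).trans (le_max_left _ _)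
  have hle : a ≤ K • (p + q) + (6 * η) • (1 : B) := by
    have e1 : a = b * H * b + b * (1 - H) * b := by
      rw [mul_sub, sub_mul, mul_one, hbb]; abel
    rw [e1]
    refine (add_le_add hp4 hq4).trans ?_
    have e2 : K • (p + q) + (6 * η) • (1 : B) =
        (K • p + (3 * η) • (1 : B)) +
        (K • q + (3 * η) • (1 : B)) := by
      rw [add_add_add_comm, ← smul_add, ← add_smul]; congr 2; ring
    rw [e2]
    refine add_le_add (add_le_add_left ?_ _) (add_le_add_left ?_ _)
    · exact smul_le_smul_of_nonneg_right (le_max_left _ _) hp0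
    · exact smul_le_smul_of_nonneg_right (le_max_right _ _) hq0
  obtain ⟨g, hg1, hg2⟩ := aux_cut a _ ha ε (6 * η) (by rw [hη]; linarith) hle
  refine aux_cuntz_of_le_conj _ (p + q) g K hK0 hg1 (cfc_nonneg fun t _ => le_max_right _ _) ?_
  rwa [mul_smul_comm, smul_mul_assoc] at hg2

end abstract_part

section matrix_part
variable {A : Type*} [CStarAlgebra A] [PartialOrder A] [StarOrderedRing A] {n : ℕ}

open CStarMatrix WithCStarModule in
theorem aux_norm_le_s18 (M : CStarMatrix (Fin n) (Fin n) A) : ‖M‖ ≤ ∑ i, ∑ j, ‖M i j‖ := by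
  rw [Finset.sum_comm, CStarMatrix.norm_def]
  refine (toCLM M).opNorm_le_bound (by positivity) fun v => ?_
  simp only [toCLM_apply_eq_sum, Finset.sum_mul]
  apply pi_norm_le_sum_norm _ |>.trans
  gcongr with i _
  rw [equiv_symm_pi_apply]
  apply norm_sum_le _ _ |>.trans
  gcongr with j _
  apply norm_mul_le _ _ |>.trans
  rw [mul_comm]
  gcongr
  exact norm_apply_le_norm v j

theorem aux_norm_le_of (M : CStarMatrix (Fin n) (Fin n) A) (e : ℝ) (h : ∀ i j, ‖M i j‖ ≤ e) :
    ‖M‖ ≤ (n : ℝ) ^ 2 * e := by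
  refine (aux_norm_le_s18 M).trans ((Finset.sum_le_sum fun i _ =>
    Finset.sum_le_sum fun j _ => h i j).trans (le_of_eq ?_))
  simp; ring

theorem aux_fin_spec_mat (C : NonUnitalStarSubalgebra ℂ A) (hC : FiniteDimensional ℂ C)
    (c : CStarMatrix (Fin n) (Fin n) A) (hc : ∀ i j, c i j ∈ C) : ∃ P : Polynomial ℂ, P ≠ 0 ∧ Polynomial.aeval c P = 0 := by
  let S : Submodule ℂ (CStarMatrix (Fin n) (Fin n) A) :=
    { carrier := {M | ∀ i j, M i j ∈ C}
      add_mem' := fun {x y} hx hy i j => by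
        rw [CStarMatrix.add_apply]; exact add_mem (hx i j) (hy i j)
      zero_mem' := fun i j => by rw [CStarMatrix.zero_apply]; exact zero_mem _
      smul_mem' := fun k x hx i j => by
        rw [CStarMatrix.smul_apply]; exact SMulMemClass.smul_mem k (hx i j) }
  let φ : S →ₗ[ℂ] (Fin n → Fin n → C) :=
    { toFun := fun M i j => ⟨M.1 i j, M.2 i j⟩
      map_add' := fun _ _ => rfl
      map_smul' := fun _ _ => rfl }
  have hφ : Function.Injective φ := by
    intro M N h
    apply Subtype.ext
    ext i j
    exact congrArg Subtype.val (congrFun (congrFun h i) j)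
  have hS : FiniteDimensional ℂ S := FiniteDimensional.of_injective φ hφ
  have hmulS : ∀ x ∈ S, c * x ∈ S := by
    intro x hx i j
    rw [CStarMatrix.mul_apply]
    exact sum_mem fun k _ => mul_mem (hc i k) (hx k j)
  have hcS : c ∈ S := hc
  have hmem : ∀ P : Polynomial ℂ, c * Polynomial.aeval c P ∈ S := by
    intro P
    induction P using Polynomial.induction_on' with
    | add p q hp hq => rw [map_add, mul_add]; exact S.add_mem hp hq
    | monomial k r =>
      rw [Polynomial.aeval_monomial, ← Algebra.smul_def, mul_smul_comm]
      refine S.smul_mem _ ?_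
      induction k with
      | zero => simpa using hcS
      | succ k ih => rw [pow_succ']; exact hmulS _ ih
  let ψ : Polynomial ℂ →ₗ[ℂ] S :=
    { toFun := fun P => ⟨c * Polynomial.aeval c P, hmem P⟩
      map_add' := fun p q => Subtype.ext (by simp [mul_add])
      map_smul' := fun k p => Subtype.ext (by simp) }
  have hψ : ¬ Function.Injective ψ := fun h =>
    Polynomial.not_finite (R := ℂ) (Module.Finite.of_injective ψ h)
  rw [injective_iff_map_eq_zero] at hψ
  push Not at hψ
  obtain ⟨P, hP, hP0⟩ := hψ
  refine ⟨Polynomial.X * P, mul_ne_zero Polynomial.X_ne_zero hP0, ?_⟩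
  rw [map_mul, Polynomial.aeval_X]
  exact congrArg Subtype.val hP

theorem aux_approx_s18 (C : NonUnitalStarSubalgebra ℂ A) (hC : FiniteDimensional ℂ C)
    (T : CStarMatrix (Fin n) (Fin n) A) (hT : IsSelfAdjoint T)
    (U : CStarMatrix (Fin n) (Fin n) A) (e η : ℝ) (he : (n : ℝ) ^ 2 * e ≤ η / 2)
    (hUT : ‖U - T‖ ≤ η / 2) (h : ∀ i j, ∃ s ∈ (C : Set A), ‖U i j - s‖ < e) :
    ∃ c : CStarMatrix (Fin n) (Fin n) A, IsSelfAdjoint c ∧ (∃ P : Polynomial ℂ, P ≠ 0 ∧ Polynomial.aeval c P = 0) ∧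
      ‖c - T‖ ≤ η := by
  choose s hs hs' using h
  let c0 : CStarMatrix (Fin n) (Fin n) A := CStarMatrix.ofMatrix (Matrix.of s)
  have hc0 : ∀ i j, c0 i j = s i j := fun i j => rfl
  have h1 : ‖U - c0‖ ≤ η / 2 :=
    (aux_norm_le_of _ e fun i j => by
      rw [CStarMatrix.sub_apply, hc0]; exact (hs' i j).le).trans he
  have h2 : ‖c0 - T‖ ≤ η := by
    have : c0 - T = (U - T) - (U - c0) := by abel
    rw [this]
    exact (norm_sub_le _ _).trans (by linarith)
  refine ⟨(1 / 2 : ℂ) • (c0 + star c0), ?_, ?_, ?_⟩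
  · rw [IsSelfAdjoint, star_smul, star_add, star_star, add_comm (star c0)]
    simp
  · refine aux_fin_spec_mat C hC _ fun i j => ?_
    rw [CStarMatrix.smul_apply, CStarMatrix.add_apply, CStarMatrix.star_apply, hc0, hc0]
    exact SMulMemClass.smul_mem _ (add_mem (hs i j) (star_mem (hs j i)))
  · have : (1 / 2 : ℂ) • (c0 + star c0) - T = (1 / 2 : ℂ) • ((c0 - T) + star (c0 - T)) := by
      rw [star_sub, hT.star_eq]
      have : T = (1 / 2 : ℂ) • (T + T) := by
        rw [← two_smul ℂ T, smul_smul]; norm_num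
      nth_rewrite 1 [this]
      rw [← smul_sub]; congr 1; abel
    rw [this, norm_smul]
    have h3 := norm_add_le (c0 - T) (star (c0 - T))
    rw [norm_star] at h3
    have : ‖(1 / 2 : ℂ)‖ = 1 / 2 := by norm_num
    rw [this]
    linarith

/-- The diagonal matrix with constant entry. -/
noncomputable def auxDiag (n : ℕ) (h : A) : CStarMatrix (Fin n) (Fin n) A :=
  CStarMatrix.ofMatrix (Matrix.diagonal fun _ => h)

theorem auxDiag_mul_apply (h : A) (M : CStarMatrix (Fin n) (Fin n) A) (i j : Fin n) :
    (auxDiag n h * M) i j = h * M i j :=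
  Matrix.diagonal_mul (fun _ => h) (M : Matrix (Fin n) (Fin n) A) i j

theorem mul_auxDiag_apply (h : A) (M : CStarMatrix (Fin n) (Fin n) A) (i j : Fin n) :
    (M * auxDiag n h) i j = M i j * h :=
  Matrix.mul_diagonal (fun _ => h) (M : Matrix (Fin n) (Fin n) A) i j

theorem auxDiag_nonneg (h : A) (hh : 0 ≤ h) : 0 ≤ auxDiag n h := by
  obtain ⟨x, rfl⟩ := CStarAlgebra.nonneg_iff_eq_star_mul_self.1 hh
  have e : (Matrix.diagonal fun _ => star x * x : Matrix (Fin n) (Fin n) A) =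
      (Matrix.diagonal fun _ => x)ᴴ * (Matrix.diagonal fun _ => x) := by
    rw [Matrix.diagonal_conjTranspose, Matrix.diagonal_mul_diagonal]
    rfl
  have : auxDiag n (star x * x) = star (auxDiag n x) * auxDiag n x := e
  rw [this]
  exact star_mul_self_nonneg _

theorem auxDiag_one_sub (h : A) : 1 - auxDiag n h = auxDiag n (1 - h) := by
  have e : (1 : Matrix (Fin n) (Fin n) A) - Matrix.diagonal (fun _ => h) =
      Matrix.diagonal (fun _ => 1 - h) := by
    rw [← Matrix.diagonal_one, Matrix.diagonal_sub]
  exact e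

theorem aux_main (hA : ∀ (X : Finset A) (ε : ℝ), 0 < ε →
    ∃ C D : NonUnitalStarSubalgebra ℂ A,
      FiniteDimensional ℂ C ∧ FiniteDimensional ℂ D ∧
      ∃ h : A, (∃ x : A, h = star x * x) ∧ ‖h‖ ≤ 1 ∧
        (∀ x ∈ X, ‖h * x - x * h‖ < ε) ∧
        (∀ x ∈ X, ∃ s ∈ (C : Set A), ‖h * x - s‖ < ε) ∧
        (∀ x ∈ X, ∃ s ∈ (D : Set A), ‖(1 - h) * x - s‖ < ε))
    (a : CStarMatrix (Fin n) (Fin n) A) (ha : 0 ≤ a) (ε : ℝ) (hε : 0 < ε) :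
    ∃ p q k : CStarMatrix (Fin n) (Fin n) A, star p = p ∧ p * p = p ∧ star q = q ∧ q * q = q ∧
      (∀ δ : ℝ, 0 < δ → ∃ s : CStarMatrix (Fin n) (Fin n) A, ‖s * a * star s - p‖ ≤ δ) ∧
      (∀ δ : ℝ, 0 < δ → ∃ s : CStarMatrix (Fin n) (Fin n) A, ‖s * a * star s - q‖ ≤ δ) ∧
      (∀ δ : ℝ, 0 < δ → ∃ s : CStarMatrix (Fin n) (Fin n) A,
        ‖s * (p + q) * star s - k‖ ≤ δ) ∧
      (∀ δ : ℝ, 0 < δ → ∃ P : Polynomial ℂ,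
        (∀ t : ℝ, t ∈ Set.Icc (0 : ℝ) (∑ i, ∑ j, ‖a i j‖) →
          ‖(Polynomial.eval (t : ℂ) P) - ((max (t - ε) 0 : ℝ) : ℂ)‖ < δ) ∧
        ‖Polynomial.aeval a P - k‖ < δ) := by
  classical
  obtain ⟨b, hbs, hbb⟩ := aux_sqrt a ha
  set η := ε / 7 with hη
  have hη0 : 0 < η := by positivity
  set N : ℝ := (n : ℝ) ^ 2 + 1 with hN
  have hN0 : 0 < N := by positivity
  set e := η / (2 * (N * (‖b‖ + 1))) with he
  have he0 : 0 < e := by positivity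
  have he1 : N * (‖b‖ + 1) * e = η / 2 := by rw [he]; field_simp
  have hNn : (n : ℝ) ^ 2 ≤ N := by rw [hN]; linarith
  have he2 : (n : ℝ) ^ 2 * e ≤ η / 2 := by
    rw [← he1]
    refine mul_le_mul_of_nonneg_right (hNn.trans (le_mul_of_one_le_right hN0.le ?_)) he0.le
    linarith [norm_nonneg b]
  have he3 : (n : ℝ) ^ 2 * e * ‖b‖ ≤ η / 2 := by
    rw [← he1, mul_right_comm]
    refine mul_le_mul_of_nonneg_right ?_ he0.le
    refine mul_le_mul hNn ?_ (norm_nonneg _) hN0.le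
    linarith
  obtain ⟨C, D, hC, hD, h, ⟨x, hx⟩, hh1, hcomm, hcC, hcD⟩ :=
    hA (Finset.univ.image (fun ij : Fin n × Fin n => a ij.1 ij.2) ∪
      Finset.univ.image (fun ij : Fin n × Fin n => b ij.1 ij.2)) e he0
  have hXa : ∀ i j, a i j ∈ (Finset.univ.image (fun ij : Fin n × Fin n => a ij.1 ij.2) ∪
      Finset.univ.image (fun ij : Fin n × Fin n => b ij.1 ij.2)) := fun i j =>
    Finset.mem_union_left _ (Finset.mem_image.2 ⟨(i, j), Finset.mem_univ _, rfl⟩)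
  have hXb : ∀ i j, b i j ∈ (Finset.univ.image (fun ij : Fin n × Fin n => a ij.1 ij.2) ∪
      Finset.univ.image (fun ij : Fin n × Fin n => b ij.1 ij.2)) := fun i j =>
    Finset.mem_union_right _ (Finset.mem_image.2 ⟨(i, j), Finset.mem_univ _, rfl⟩)
  have hh0 : 0 ≤ h := hx ▸ star_mul_self_nonneg x
  have hh1' : h ≤ 1 := (CStarAlgebra.norm_le_one_iff_of_nonneg h hh0).1 hh1
  set H := auxDiag n h with hH
  have hH0 : 0 ≤ H := auxDiag_nonneg h hh0
  have hH1 : 0 ≤ 1 - H := by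
    rw [hH, auxDiag_one_sub]; exact auxDiag_nonneg _ (sub_nonneg.2 hh1')
  have hHb : ‖H * b - b * H‖ ≤ (n : ℝ) ^ 2 * e := by
    refine aux_norm_le_of _ e fun i j => ?_
    rw [CStarMatrix.sub_apply, hH, auxDiag_mul_apply, mul_auxDiag_apply]
    exact (hcomm _ (hXb i j)).le
  have hd : ‖H * a - b * H * b‖ ≤ η / 2 := by
    have : H * a - b * H * b = (H * b - b * H) * b := by rw [sub_mul, mul_assoc H, hbb]
    rw [this]
    refine (norm_mul_le _ _).trans (le_trans ?_ he3)
    exact mul_le_mul_of_nonneg_right hHb (norm_nonneg _)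
  have hd' : ‖(1 - H) * a - b * (1 - H) * b‖ ≤ η / 2 := by
    have : (1 - H) * a - b * (1 - H) * b = -(H * a - b * H * b) := by
      rw [mul_sub, sub_mul, sub_mul, mul_one, one_mul, hbb]; abel
    rw [this, norm_neg]; exact hd
  have hsa : ∀ K : CStarMatrix (Fin n) (Fin n) A, 0 ≤ K → IsSelfAdjoint (b * K * b) := by
    intro K hK
    have := (IsSelfAdjoint.of_nonneg hK).conjugate b
    rwa [hbs] at this
  obtain ⟨c, hc1, hc2, hc3⟩ := aux_approx_s18 C hC (b * H * b) (hsa _ hH0) (H * a) e η he2 hd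
    (fun i j => by rw [hH, auxDiag_mul_apply]; exact hcC _ (hXa i j))
  obtain ⟨d, hd1, hd2, hd3⟩ := aux_approx_s18 D hD (b * (1 - H) * b) (hsa _ hH1) ((1 - H) * a) e η
    he2 hd' (fun i j => by
      rw [hH, auxDiag_one_sub, auxDiag_mul_apply]; exact hcD _ (hXa i j))
  obtain ⟨p, q, k, h1, h2, h3, h4, h5, h6, h7, h8⟩ :=
    aux_core a b H c d ha hbs hbb hH0 hH1 ε hε hc1 hc2 hc3 hd1 hd2 hd3
  exact ⟨p, q, k, h1, h2, h3, h4, h5, h6, h7, h8 _ (aux_norm_le_s18 a)⟩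

end matrix_part

/-- Lemma 3.14 of the paper.  Let `A` be a unital C*-algebra with weak
complexity rank at most one.  Then for any `n ≥ 1`, any positive `a ∈ M_n(A)` and any
`ε > 0` there exist `m ≥ 1` and a projection `p ∈ M_m(A)` such that `(a - ε)₊ ≲ p` and
`p ≲ a ⊕ a`. -/
theorem exists_projection_cuntz_between {A : Type u} [CStarAlgebra A] (hA : WeakCRLeOne A)
    (n : ℕ) (hn : 1 ≤ n) (a : Matrix (Fin n) (Fin n) A)
    (ha : ∃ y : Matrix (Fin n) (Fin n) A, a = star y * y) (ε : ℝ) (hε : 0 < ε) :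
    ∃ m : ℕ, 1 ≤ m ∧ ∃ p : Matrix (Fin m) (Fin m) A, star p = p ∧ p * p = p ∧
      (∃ c : Matrix (Fin n) (Fin n) A, IsCutoffApprox ε a c ∧ CuntzLE c p) ∧
      CuntzLE p (Matrix.fromBlocks a 0 0 a) := by
  classical
  let _ : PartialOrder A := CStarAlgebra.spectralOrder A
  have _ : StarOrderedRing A := CStarAlgebra.spectralOrderedRing A
  let a' : CStarMatrix (Fin n) (Fin n) A := CStarMatrix.ofMatrix a
  have ha' : 0 ≤ a' := by
    obtain ⟨y, hy⟩ := ha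
    have : a' = star (CStarMatrix.ofMatrix y) * CStarMatrix.ofMatrix y := hy
    rw [this]
    exact star_mul_self_nonneg _
  obtain ⟨p, q, k, hp1, hp2, hq1, hq2, hpa, hqa, hcut, hpoly⟩ := aux_main hA a' ha' ε hε
  have hp1' : (p : Matrix (Fin n) (Fin n) A)ᴴ = p := hp1
  have hq1' : (q : Matrix (Fin n) (Fin n) A)ᴴ = q := hq1
  have hp2' : @HMul.hMul (Matrix (Fin n) (Fin n) A) (Matrix (Fin n) (Fin n) A)
    (Matrix (Fin n) (Fin n) A) _ p p = p := hp2
  have hq2' : @HMul.hMul (Matrix (Fin n) (Fin n) A) (Matrix (Fin n) (Fin n) A)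
    (Matrix (Fin n) (Fin n) A) _ q q = q := hq2
  let f : Fin (n + n) ≃ Fin n ⊕ Fin n := finSumFinEquiv.symm
  let p' : Matrix (Fin n) (Fin n) A := p
  let q' : Matrix (Fin n) (Fin n) A := q
  let P : Matrix (Fin n ⊕ Fin n) (Fin n ⊕ Fin n) A := Matrix.fromBlocks p' 0 0 q'
  refine ⟨n + n, by omega, P.submatrix f f, ?_, ?_, ?_, ?_⟩
  · rw [Matrix.star_eq_conjTranspose, Matrix.conjTranspose_submatrix]
    congr 1
    simp only [P, Matrix.fromBlocks_conjTranspose, Matrix.conjTranspose_zero]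
    rw [hp1', hq1']
  · rw [Matrix.submatrix_mul_equiv]
    congr 1
    simp only [P, Matrix.fromBlocks_multiply, Matrix.mul_zero, Matrix.zero_mul, add_zero, zero_add]
    rw [hp2', hq2']
  · refine ⟨k, ?_, ?_⟩
    · intro δ hδ
      obtain ⟨R, hR1, hR2⟩ := hpoly δ hδ
      exact ⟨R, hR1, fun i j => lt_of_le_of_lt CStarMatrix.norm_entry_le_norm hR2⟩
    · intro δ hδ
      obtain ⟨s, hs⟩ := hcut (δ / 2) (by positivity)
      let s' : Matrix (Fin n) (Fin n) A := s
      refine ⟨(Matrix.fromCols s' s').submatrix id f, fun i j => ?_⟩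
      have e1 : (Matrix.fromCols s' s').submatrix id f * P.submatrix f f *
          ((Matrix.fromCols s' s').submatrix id f)ᴴ = s' * (p' + q') * s'ᴴ := by
        rw [Matrix.conjTranspose_submatrix, Matrix.submatrix_mul_equiv,
          Matrix.submatrix_mul_equiv, Matrix.submatrix_id_id]
        simp only [P]
        rw [Matrix.conjTranspose_fromCols_eq_fromRows_conjTranspose,
          Matrix.fromCols_mul_fromBlocks, Matrix.fromCols_mul_fromRows]
        simp [Matrix.mul_add, Matrix.add_mul]
      rw [e1]
      refine lt_of_le_of_lt (le_trans ?_ hs) (half_lt_self hδ)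
      exact CStarMatrix.norm_entry_le_norm
        (M := s * (p + q) * star s - k)
  · intro δ hδ
    obtain ⟨s, hs⟩ := hpa (δ / 2) (by positivity)
    obtain ⟨r, hr⟩ := hqa (δ / 2) (by positivity)
    let s' : Matrix (Fin n) (Fin n) A := s
    let r' : Matrix (Fin n) (Fin n) A := r
    refine ⟨(Matrix.fromBlocks s' 0 0 r').submatrix f id, fun i j => ?_⟩
    have e1 : (Matrix.fromBlocks s' 0 0 r').submatrix f id * Matrix.fromBlocks a 0 0 a *
        ((Matrix.fromBlocks s' 0 0 r').submatrix f id)ᴴ - P.submatrix f f =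
        (Matrix.fromBlocks (s' * a * s'ᴴ - p') 0 0 (r' * a * r'ᴴ - q')).submatrix f f := by
      have e0 : (Matrix.fromBlocks s' 0 0 r').submatrix f id * Matrix.fromBlocks a 0 0 a *
        ((Matrix.fromBlocks s' 0 0 r').submatrix f id)ᴴ =
        (Matrix.fromBlocks s' 0 0 r' * Matrix.fromBlocks a 0 0 a *
          (Matrix.fromBlocks s' 0 0 r')ᴴ).submatrix f f := rfl
      have e2 : Matrix.fromBlocks s' 0 0 r' * Matrix.fromBlocks a 0 0 a *
          (Matrix.fromBlocks s' 0 0 r')ᴴ - P =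
          Matrix.fromBlocks (s' * a * s'ᴴ - p') 0 0 (r' * a * r'ᴴ - q') := by
        simp [P, Matrix.fromBlocks_multiply, Matrix.fromBlocks_conjTranspose,
          sub_eq_add_neg, Matrix.fromBlocks_neg, Matrix.fromBlocks_add]
      rw [e0, ← e2]
      rfl
    rw [e1, Matrix.submatrix_apply]
    rcases f i with i | i <;> rcases f j with j | j
    · refine lt_of_le_of_lt (le_trans ?_ hs) (half_lt_self hδ)
      exact CStarMatrix.norm_entry_le_norm (M := s * a' * star s - p)
    · simpa using hδ
    · simpa using hδ
    · refine lt_of_le_of_lt (le_trans ?_ hr) (half_lt_self hδ)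
      exact CStarMatrix.norm_entry_le_norm (M := r * a' * star r - q)
end
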